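/- arXiv:1807.04699 — 2 statements merged into one kernel-verified Lean document; each statement's English description precedes it below -/
import Mathlib

section
/- Let n ≥ 1 and suppose 1 < p < ∞, 1 < q' < ∞, q is the Hölder conjugate of q' (1/q + 1/q' = 1), p' is the Hölder conjugate of p, 0 < λ < n, α + β ≥ 0, λ + α + β ≤ n, β < n/p', α < n/q, and 1/p + 1/q' + (λ+α+β)/n = 2. Then there exists a constant C_{n,α,β,p,q'} > 0 such that for all f ∈ L^{q'}(ℝⁿ) and g ∈ L^{p}(ℝⁿ), ∫_{ℝⁿ}∫_{ℝⁿ} |f(x)| |g(y)| / (|x|^{α} |x−y|^{λ} |y|^{β}) dx dy ≤ C_{n,α,β,p,q'} ‖f‖_{L^{q'}(ℝⁿ)} ‖g‖_{L^{p}(ℝⁿ)}. (Here no sign condition is imposed on α and β individually, only α + β ≥ 0.) -/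
open MeasureTheory ENNReal Filter

noncomputable section

/-- A model integrable radial function on a space of dimension `N`. -/
def radialProfile (N η r : ℝ) : ℝ := if r < 1 then r ^ (η - N) else r ^ (-N - η)

/-- The `L¹`-normalized dilation of `radialProfile`. -/
def dilatedProfile (N η c r : ℝ) : ℝ := c ^ N * radialProfile N η (c * r)

lemma radialProfile_nonneg {N η r : ℝ} (hr : 0 ≤ r) : 0 ≤ radialProfile N η r := by
  unfold radialProfile
  split_ifs <;> positivity

lemma dilatedProfile_nonneg {N η c r : ℝ} (hc : 0 ≤ c) (hr : 0 ≤ r) :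
    0 ≤ dilatedProfile N η c r :=
  mul_nonneg (Real.rpow_nonneg hc _) (radialProfile_nonneg (mul_nonneg hc hr))

lemma radialProfile_antitone {N η η' r : ℝ} (hr : 0 < r) (h : η' ≤ η) :
    radialProfile N η r ≤ radialProfile N η' r := by
  unfold radialProfile
  split_ifs with h1
  · exact Real.rpow_le_rpow_of_exponent_ge hr h1.le (by linarith)
  · exact Real.rpow_le_rpow_of_exponent_le (not_lt.mp h1) (by linarith)

lemma dilatedProfile_antitone {N η η' c r : ℝ} (hN : 0 < N) (hc : 0 ≤ c) (hr : 0 < r)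
    (h : η' ≤ η) : dilatedProfile N η c r ≤ dilatedProfile N η' c r := by
  unfold dilatedProfile
  rcases hc.eq_or_lt with rfl | hc
  · simp [Real.zero_rpow hN.ne']
  · exact mul_le_mul_of_nonneg_left (radialProfile_antitone (mul_pos hc hr) h) (by positivity)

@[fun_prop]
lemma measurable_radialProfile (N η : ℝ) : Measurable (radialProfile N η) :=
  Measurable.ite measurableSet_Iio (by fun_prop) (by fun_prop)

/-- The integrand that controls the Stein–Weiss form pointwise. Here `F`, `G` are the powers of
the two functions that are integrable, and `X`, `Y`, `Z` stand for `‖x‖`, `‖y‖`, `‖x - y‖`. -/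
def majorant (N η F G X Y Z : ℝ) : ℝ :=
  F * G
    + F * (dilatedProfile N η X⁻¹ Y + dilatedProfile N η X⁻¹ Z
        + dilatedProfile N η (F ^ N⁻¹) Z)
    + G * (dilatedProfile N η Y⁻¹ X + dilatedProfile N η Y⁻¹ Z
        + dilatedProfile N η (G ^ N⁻¹) Z)

lemma majorant_swap (N η F G X Y Z : ℝ) :
    majorant N η F G X Y Z = majorant N η G F Y X Z := by
  unfold majorant; ring

lemma majorant_antitone {N η η' F G X Y Z : ℝ} (hN : 0 < N) (hF : 0 ≤ F) (hG : 0 ≤ G)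
    (hX : 0 < X) (hY : 0 < Y) (hZ : 0 < Z) (h : η' ≤ η) :
    majorant N η F G X Y Z ≤ majorant N η' F G X Y Z := by
  have key {c r : ℝ} (hc : 0 ≤ c) (hr : 0 < r) :=
    dilatedProfile_antitone hN hc hr h
  unfold majorant
  gcongr <;> exact key (by positivity) (by assumption)

lemma le_majorant_of_nonneg {N η F G X Y Z : ℝ} (hF : 0 ≤ F) (hG : 0 ≤ G)
    (hX : 0 < X) (hY : 0 < Y) (hZ : 0 < Z) :
    F * G + F * dilatedProfile N η X⁻¹ Y + G * dilatedProfile N η Y⁻¹ X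
        ≤ majorant N η F G X Y Z ∧
      F * G + F * dilatedProfile N η X⁻¹ Z + G * dilatedProfile N η Y⁻¹ Z
        ≤ majorant N η F G X Y Z ∧
      F * G + G * dilatedProfile N η (G ^ N⁻¹) Z ≤ majorant N η F G X Y Z := by
  have key {c r : ℝ} (hc : 0 ≤ c) (hr : 0 < r) : 0 ≤ dilatedProfile N η c r :=
    dilatedProfile_nonneg hc hr.le
  have h1 := mul_nonneg hF (key (inv_nonneg.2 hX.le) hY)
  have h2 := mul_nonneg hF (key (inv_nonneg.2 hX.le) hZ)
  have h3 := mul_nonneg hF (key (Real.rpow_nonneg hF N⁻¹) hZ)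
  have h4 := mul_nonneg hG (key (inv_nonneg.2 hY.le) hX)
  have h5 := mul_nonneg hG (key (inv_nonneg.2 hY.le) hZ)
  have h6 := mul_nonneg hG (key (Real.rpow_nonneg hG N⁻¹) hZ)
  unfold majorant
  refine ⟨?_, ?_, ?_⟩ <;> linarith

/-- The pointwise estimate behind Young's convolution inequality. -/
lemma rpow_mul_rpow_mul_le_young {u v F G A B : ℝ} (hu : 0 < u) (hu1 : u ≤ 1) (hv : 0 < v)
    (hv1 : v ≤ 1) (huv : 1 ≤ u + v) (hF : 0 ≤ F) (hG : 0 ≤ G) (hA : 0 ≤ A) (hB : 0 ≤ B) :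
    F ^ u * G ^ v * (A ^ (1 - v) * B ^ (1 - u)) ≤ F * G + F * A + G * B := by
  have h := Real.geom_mean_le_arith_mean3_weighted (w₁ := 1 - v) (w₂ := 1 - u)
    (w₃ := u + v - 1) (p₁ := F * A) (p₂ := G * B) (p₃ := F * G) (by linarith) (by linarith)
    (by linarith) (by positivity) (by positivity) (by positivity) (by ring)
  have e : (F * A) ^ (1 - v) * (G * B) ^ (1 - u) * (F * G) ^ (u + v - 1)
      = F ^ u * G ^ v * (A ^ (1 - v) * B ^ (1 - u)) := by
    have eF : F ^ u = F ^ (1 - v) * F ^ (u + v - 1) := by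
      rw [← Real.rpow_add_of_nonneg hF (by linarith) (by linarith)]; ring_nf
    have eG : G ^ v = G ^ (1 - u) * G ^ (u + v - 1) := by
      rw [← Real.rpow_add_of_nonneg hG (by linarith) (by linarith)]; ring_nf
    rw [Real.mul_rpow hF hA, Real.mul_rpow hG hB, Real.mul_rpow hF hG, eF, eG]
    ring
  rw [e] at h
  have h1 : (1 - v) * (F * A) ≤ F * A := mul_le_of_le_one_left (by positivity) (by linarith)
  have h2 : (1 - u) * (G * B) ≤ G * B := mul_le_of_le_one_left (by positivity) (by linarith)
  have h3 : (u + v - 1) * (F * G) ≤ F * G := mul_le_of_le_one_left (by positivity) (by linarith)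
  linarith

lemma exp_rpow (x y : ℝ) : Real.exp x ^ y = Real.exp (x * y) := (Real.exp_mul x y).symm

/-- The kernel in the region where `‖y‖` is small compared with `‖x‖`. -/
lemma steinWeiss_pointwise_far {N u v lam α β : ℝ} (hu : 0 < u) (hu1 : u < 1)
    (hv : 0 < v) (hv1 : v < 1) (huv : 1 ≤ u + v) (hlam : 0 < lam)
    (hbal : N * (u + v) + (lam + α + β) = 2 * N) (hβ : β < N * (1 - v)) :
    ∃ η > 0, ∃ C > 0, ∀ F G X Y Z : ℝ, 0 ≤ F → 0 ≤ G → 0 < X → 0 < Y → 0 < Z →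
      X ≤ Y + Z → 2 * Y ≤ X →
      F ^ u * G ^ v * (X ^ (-α) * Y ^ (-β) * Z ^ (-lam)) ≤ C * majorant N η F G X Y Z := by
  have hθ : 0 < 2 - u - v := by linarith
  set δ := (N * (1 - v) - β) / (2 - u - v)
  have hδe : δ * (2 - u - v) = N * (1 - v) - β := div_mul_cancel₀ _ hθ.ne'
  have hδpos : 0 < δ := div_pos (by linarith) hθ
  refine ⟨δ, hδpos, 2 ^ lam, by positivity, fun F G X Y Z hF hG hX hY hZ hXYZ hYX => ?_⟩
  have hA : dilatedProfile N δ X⁻¹ Y = X ^ (-N) * (Y / X) ^ (δ - N) := by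
    rw [dilatedProfile, radialProfile, if_pos (by rw [inv_mul_lt_iff₀ hX]; linarith),
      Real.inv_rpow hX.le, ← Real.rpow_neg hX.le, inv_mul_eq_div X Y]
  have hB : dilatedProfile N δ Y⁻¹ X = Y ^ (-N) * (X / Y) ^ (-N - δ) := by
    rw [dilatedProfile, radialProfile,
      if_neg (by rw [not_lt, le_inv_mul_iff₀ hY]; linarith),
      Real.inv_rpow hY.le, ← Real.rpow_neg hY.le, inv_mul_eq_div Y X]
  have hZle : Z ^ (-lam) ≤ 2 ^ lam * X ^ (-lam) := by
    have h1 : Z ^ (-lam) ≤ (X / 2) ^ (-lam) :=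
      Real.rpow_le_rpow_of_nonpos (by linarith) (by linarith) (by linarith)
    rw [Real.div_rpow hX.le (by norm_num), Real.rpow_neg (by norm_num : (0 : ℝ) ≤ 2),
      div_inv_eq_mul] at h1
    linarith
  have hAB : X ^ (-α) * Y ^ (-β) * X ^ (-lam)
      = (X ^ (-N) * (Y / X) ^ (δ - N)) ^ (1 - v)
        * (Y ^ (-N) * (X / Y) ^ (-N - δ)) ^ (1 - u) := by
    obtain ⟨ξ, rfl⟩ : ∃ ξ, X = Real.exp ξ := ⟨Real.log X, (Real.exp_log hX).symm⟩
    obtain ⟨υ, rfl⟩ : ∃ υ, Y = Real.exp υ := ⟨Real.log Y, (Real.exp_log hY).symm⟩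
    simp only [← Real.exp_sub, exp_rpow, ← Real.exp_add]
    congr 1
    linear_combination (-ξ) * hbal + (υ - ξ) * (-hδe)
  calc F ^ u * G ^ v * (X ^ (-α) * Y ^ (-β) * Z ^ (-lam))
      ≤ F ^ u * G ^ v * (X ^ (-α) * Y ^ (-β) * (2 ^ lam * X ^ (-lam))) := by gcongr
    _ = 2 ^ lam * (F ^ u * G ^ v * (X ^ (-α) * Y ^ (-β) * X ^ (-lam))) := by ring
    _ ≤ 2 ^ lam * majorant N δ F G X Y Z := by
      gcongr
      rw [hAB, ← hA, ← hB]
      exact (rpow_mul_rpow_mul_le_young hu hu1.le hv hv1.le huv hF hG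
        (dilatedProfile_nonneg (by positivity) hY.le)
        (dilatedProfile_nonneg (by positivity) hX.le)).trans
        (le_majorant_of_nonneg hF hG hX hY hZ).1

lemma dilatedProfile_inv_ge {N η X Z : ℝ} (hη : 0 < η) (hX : 0 < X) (hZ : 0 < Z)
    (h : Z ≤ 3 * X) :
    X ^ (-η) * Z ^ (η - N) ≤ 3 ^ (2 * η) * dilatedProfile N η X⁻¹ Z := by
  have h1 : X ^ (-η) * Z ^ (η - N) = (X⁻¹) ^ N * (X⁻¹ * Z) ^ (η - N) := by
    rw [Real.mul_rpow (by positivity) hZ.le, ← mul_assoc, ← Real.rpow_add (by positivity),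
      Real.inv_rpow hX.le, ← Real.rpow_neg hX.le]
    ring_nf
  have h3 : X⁻¹ * Z ≤ 3 := by rw [inv_mul_le_iff₀ hX]; linarith
  have hr : 0 < X⁻¹ * Z := by positivity
  rw [h1, dilatedProfile, mul_left_comm]
  gcongr
  generalize X⁻¹ * Z = r at *
  unfold radialProfile
  split_ifs with hr1
  · exact le_mul_of_one_le_left (by positivity)
      (Real.one_le_rpow (by norm_num) (by linarith))
  · calc r ^ (η - N) = r ^ (2 * η) * r ^ (-N - η) := by
          rw [← Real.rpow_add hr]; ring_nf
      _ ≤ _ := by gcongr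

/-- The kernel in the region where `‖x‖` and `‖y‖` are comparable, when `α + β > 0`. -/
lemma steinWeiss_pointwise_near_of_pos {N u v lam α β : ℝ} (hu : 0 < u)
    (hu1 : u < 1) (hv : 0 < v) (hv1 : v < 1) (huv : 1 ≤ u + v)
    (hab : 0 < α + β) (hbal : N * (u + v) + (lam + α + β) = 2 * N) :
    ∃ η > 0, ∃ C > 0, ∀ F G X Y Z : ℝ, 0 ≤ F → 0 ≤ G → 0 < X → 0 < Y → 0 < Z →
      Z ≤ X + Y → X ≤ 2 * Y → Y ≤ 2 * X →
      F ^ u * G ^ v * (X ^ (-α) * Y ^ (-β) * Z ^ (-lam)) ≤ C * majorant N η F G X Y Z := by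
  have hθ : 0 < 2 - u - v := by linarith
  set η := (α + β) / (2 - u - v)
  have hηe : η * (2 - u - v) = α + β := div_mul_cancel₀ _ hθ.ne'
  have hη : 0 < η := div_pos hab hθ
  set κ := η * (1 - v) - α with hκ
  refine ⟨η, hη, 2 ^ |κ| * (3 ^ (2 * η)), by positivity,
    fun F G X Y Z hF hG hX hY hZ hZXY hXY hYX => ?_⟩
  have hK : X ^ (-α) * Y ^ (-β) * Z ^ (-lam) ≤ 2 ^ |κ| *
      ((X ^ (-η) * Z ^ (η - N)) ^ (1 - v) * (Y ^ (-η) * Z ^ (η - N)) ^ (1 - u)) := by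
    have hl1 : Real.log X ≤ Real.log 2 + Real.log Y := by
      rw [← Real.log_mul (by norm_num) hY.ne']; exact Real.log_le_log hX hXY
    have hl2 : Real.log Y ≤ Real.log 2 + Real.log X := by
      rw [← Real.log_mul (by norm_num) hX.ne']; exact Real.log_le_log hY hYX
    rw [← Real.exp_log (by norm_num : (0 : ℝ) < 2)]
    rw [← Real.exp_log hX, ← Real.exp_log hY, ← Real.exp_log hZ]
    generalize Real.log X = ξ at *
    generalize Real.log Y = υ at *
    generalize Real.log Z = ζ at *
    simp only [exp_rpow, ← Real.exp_add]
    rw [Real.exp_le_exp]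
    have hab' : κ * (ξ - υ) ≤ Real.log 2 * |κ| := by
      calc κ * (ξ - υ) ≤ |κ * (ξ - υ)| := le_abs_self _
        _ = |ξ - υ| * |κ| := by rw [abs_mul, mul_comm]
        _ ≤ _ := by gcongr; rw [abs_le]; constructor <;> linarith
    have e : ξ * -α + υ * -β + ζ * -lam = κ * (ξ - υ) +
        ((ξ * -η + ζ * (η - N)) * (1 - v) + (υ * -η + ζ * (η - N)) * (1 - u)) := by
      rw [hκ]
      linear_combination (υ - ζ) * hηe - ζ * hbal
    linarith
  have hA := dilatedProfile_inv_ge (N := N) hη hX hZ (by linarith)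
  have hB := dilatedProfile_inv_ge (N := N) hη hY hZ (by linarith)
  have h3 : (1 : ℝ) ≤ 3 ^ (2 * η) := Real.one_le_rpow (by norm_num) (by linarith)
  calc F ^ u * G ^ v * (X ^ (-α) * Y ^ (-β) * Z ^ (-lam))
      ≤ F ^ u * G ^ v * (2 ^ |κ| * ((X ^ (-η) * Z ^ (η - N)) ^ (1 - v)
        * (Y ^ (-η) * Z ^ (η - N)) ^ (1 - u))) := by gcongr
    _ = 2 ^ |κ| * (F ^ u * G ^ v * ((X ^ (-η) * Z ^ (η - N)) ^ (1 - v)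
        * (Y ^ (-η) * Z ^ (η - N)) ^ (1 - u))) := by ring
    _ ≤ 2 ^ |κ| * (F * G + F * (X ^ (-η) * Z ^ (η - N)) + G * (Y ^ (-η) * Z ^ (η - N))) := by
      gcongr
      exact rpow_mul_rpow_mul_le_young hu hu1.le hv hv1.le huv hF hG (by positivity)
        (by positivity)
    _ ≤ 2 ^ |κ| * (3 ^ (2 * η) * (F * G) + F * (3 ^ (2 * η) * dilatedProfile N η X⁻¹ Z)
        + G * (3 ^ (2 * η) * dilatedProfile N η Y⁻¹ Z)) := by
      refine mul_le_mul_of_nonneg_left (add_le_add (add_le_add ?_ (by gcongr)) (by gcongr))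
        (by positivity)
      exact le_mul_of_one_le_left (mul_nonneg hF hG) h3
    _ = 2 ^ |κ| * 3 ^ (2 * η) * (F * G + F * dilatedProfile N η X⁻¹ Z
        + G * dilatedProfile N η Y⁻¹ Z) := by ring
    _ ≤ _ := by
      gcongr
      exact (le_majorant_of_nonneg hF hG hX hY hZ).2.1

/-- The pointwise form of the Hardy–Littlewood–Sobolev inequality, in the case `F ≤ G`. -/
lemma hardyLittlewoodSobolev_pointwise {N η u v lam F G Z : ℝ} (hN : 0 < N) (hu : 0 < u)
    (hu1 : u < 1) (hbal : N * (u + v) + lam = 2 * N) (hη : η ≤ N - lam)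
    (hη' : η ≤ lam / (1 - u) - N) (hF : 0 ≤ F) (hFG : F ≤ G) (hZ : 0 < Z) :
    F ^ u * G ^ v * Z ^ (-lam) ≤ F * G + G * dilatedProfile N η (G ^ N⁻¹) Z := by
  have hu1' : 0 < 1 - u := by linarith
  rcases (hF.trans hFG).eq_or_lt with rfl | hG
  · obtain rfl : F = 0 := le_antisymm hFG hF
    simp [Real.zero_rpow hu.ne']
  set t := F / G with ht
  set w := G ^ N⁻¹ * Z with hw
  have ht0 : 0 ≤ t := by positivity
  have ht1 : t ≤ 1 := (div_le_one hG).2 hFG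
  have hw0 : 0 < w := by positivity
  have key : t ^ u * w ^ (-lam) ≤ t + radialProfile N η w := by
    unfold radialProfile
    split_ifs with hw1
    · have h1 : t ^ u ≤ 1 := Real.rpow_le_one ht0 ht1 hu.le
      have h2 : w ^ (-lam) ≤ w ^ (η - N) :=
        Real.rpow_le_rpow_of_exponent_ge hw0 hw1.le (by linarith)
      calc t ^ u * w ^ (-lam) ≤ 1 * w ^ (η - N) := by gcongr
        _ ≤ _ := by linarith
    · have h1 := Real.geom_mean_le_arith_mean2_weighted hu.le hu1'.le ht0
        (by positivity : 0 ≤ w ^ (-(lam / (1 - u)))) (by ring)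
      rw [← Real.rpow_mul hw0.le, neg_mul, div_mul_cancel₀ _ hu1'.ne'] at h1
      have h2 : w ^ (-(lam / (1 - u))) ≤ w ^ (-N - η) :=
        Real.rpow_le_rpow_of_exponent_le (not_lt.mp hw1) (by linarith)
      have h3 : 0 ≤ w ^ (-(lam / (1 - u))) := by positivity
      nlinarith
  have eF : F = G * t := by rw [ht]; field_simp
  have eG : (G ^ N⁻¹) ^ N = G := Real.rpow_inv_rpow hG.le hN.ne'
  have e : F ^ u * G ^ v * Z ^ (-lam) = G * G * (t ^ u * w ^ (-lam)) := by
    rw [hw, Real.mul_rpow (by positivity) hZ.le, ← Real.rpow_mul hG.le, eF,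
      Real.mul_rpow hG.le ht0]
    have h : G ^ u * G ^ v = G * G * G ^ (N⁻¹ * -lam) := by
      rw [← Real.rpow_add hG]
      nth_rw 2 3 [← Real.rpow_one G]
      rw [← Real.rpow_add hG, ← Real.rpow_add hG]
      congr 1
      field_simp
      linarith
    calc G ^ u * t ^ u * G ^ v * Z ^ (-lam) = G ^ u * G ^ v * (t ^ u * Z ^ (-lam)) := by ring
      _ = _ := by rw [h]; ring
  rw [e, dilatedProfile, eG, ← hw]
  calc G * G * (t ^ u * w ^ (-lam)) ≤ G * G * (t + radialProfile N η w) := by gcongr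
    _ = G * t * G + G * (G * radialProfile N η w) := by ring
    _ = _ := by rw [← eF]

/-- The kernel in the region where `‖x‖` and `‖y‖` are comparable, when `α + β = 0`. -/
lemma steinWeiss_pointwise_near_of_eq {N u v lam α β : ℝ} (hN : 0 < N) (hu : 0 < u)
    (hu1 : u < 1) (hv : 0 < v) (hv1 : v < 1) (hlamN : lam < N)
    (hab : α + β = 0) (hbal : N * (u + v) + (lam + α + β) = 2 * N) :
    ∃ η > 0, ∃ C > 0, ∀ F G X Y Z : ℝ, 0 ≤ F → 0 ≤ G → 0 < X → 0 < Y → 0 < Z →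
      X ≤ 2 * Y → Y ≤ 2 * X →
      F ^ u * G ^ v * (X ^ (-α) * Y ^ (-β) * Z ^ (-lam)) ≤ C * majorant N η F G X Y Z := by
  have hu1' : 0 < 1 - u := by linarith
  have hv1' : 0 < 1 - v := by linarith
  have hbal' : N * (u + v) + lam = 2 * N := by linarith
  have h1 : 0 < lam / (1 - u) - N := by
    rw [sub_pos, lt_div_iff₀ hu1']; nlinarith
  have h2 : 0 < lam / (1 - v) - N := by
    rw [sub_pos, lt_div_iff₀ hv1']; nlinarith
  refine ⟨min (N - lam) (min (lam / (1 - u) - N) (lam / (1 - v) - N)),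
    lt_min (by linarith) (lt_min h1 h2), 2 ^ |α|, by positivity,
    fun F G X Y Z hF hG hX hY hZ hXY hYX => ?_⟩
  set η := min (N - lam) (min (lam / (1 - u) - N) (lam / (1 - v) - N))
  have hη1 : η ≤ N - lam := min_le_left _ _
  have hη2 : η ≤ lam / (1 - u) - N := (min_le_right _ _).trans (min_le_left _ _)
  have hη3 : η ≤ lam / (1 - v) - N := (min_le_right _ _).trans (min_le_right _ _)
  have hXYα : X ^ (-α) * Y ^ (-β) ≤ 2 ^ |α| := by
    have e : X ^ (-α) * Y ^ (-β) = (Y / X) ^ α := by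
      rw [Real.div_rpow hY.le hX.le, Real.rpow_neg hX.le, show -β = α by linarith]
      field_simp
    rw [e]
    rcases le_total 0 α with h | h
    · rw [abs_of_nonneg h]
      exact Real.rpow_le_rpow (by positivity) ((div_le_iff₀ hX).2 hYX) h
    · rw [abs_of_nonpos h, ← inv_div, Real.inv_rpow (by positivity),
        ← Real.rpow_neg (by positivity)]
      exact Real.rpow_le_rpow (by positivity) ((div_le_iff₀ hY).2 hXY) (by linarith)
  have main : F ^ u * G ^ v * Z ^ (-lam) ≤ majorant N η F G X Y Z := by
    rcases le_total F G with h | h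
    · exact (hardyLittlewoodSobolev_pointwise hN hu hu1 hbal' hη1 hη2 hF h hZ).trans
        (le_majorant_of_nonneg hF hG hX hY hZ).2.2
    · rw [majorant_swap, mul_comm (F ^ u)]
      exact (hardyLittlewoodSobolev_pointwise hN hv hv1 (by linarith) hη1 hη3 hG h hZ).trans
        (le_majorant_of_nonneg hG hF hY hX hZ).2.2
  calc F ^ u * G ^ v * (X ^ (-α) * Y ^ (-β) * Z ^ (-lam))
      ≤ F ^ u * G ^ v * (2 ^ |α| * Z ^ (-lam)) := by gcongr
    _ = 2 ^ |α| * (F ^ u * G ^ v * Z ^ (-lam)) := by ring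
    _ ≤ _ := by gcongr

lemma majorant_nonneg {N η F G X Y Z : ℝ} (hF : 0 ≤ F) (hG : 0 ≤ G)
    (hX : 0 < X) (hY : 0 < Y) (hZ : 0 < Z) : 0 ≤ majorant N η F G X Y Z :=
  (by
    have := dilatedProfile_nonneg (N := N) (η := η) (Real.rpow_nonneg hG N⁻¹) hZ.le
    positivity : 0 ≤ F * G + G * dilatedProfile N η (G ^ N⁻¹) Z).trans
    (le_majorant_of_nonneg hF hG hX hY hZ).2.2

/-- Pointwise domination of the Stein–Weiss integrand. -/
lemma steinWeiss_pointwise {N u v lam α β : ℝ} (hN : 0 < N) (hu : 0 < u) (hu1 : u < 1)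
    (hv : 0 < v) (hv1 : v < 1) (huv : 1 ≤ u + v) (hlam : 0 < lam) (hlamN : lam < N)
    (hab : 0 ≤ α + β) (hbal : N * (u + v) + (lam + α + β) = 2 * N)
    (hβ : β < N * (1 - v)) (hα : α < N * (1 - u)) :
    ∃ η > 0, ∃ C > 0, ∀ F G X Y Z : ℝ, 0 ≤ F → 0 ≤ G → 0 < X → 0 < Y → 0 < Z →
      Z ≤ X + Y → X ≤ Y + Z → Y ≤ X + Z →
      F ^ u * G ^ v * (X ^ (-α) * Y ^ (-β) * Z ^ (-lam)) ≤ C * majorant N η F G X Y Z := by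
  obtain ⟨η₁, hη₁, C₁, hC₁, h₁⟩ :=
    steinWeiss_pointwise_far hu hu1 hv hv1 huv hlam hbal hβ
  obtain ⟨η₂, hη₂, C₂, hC₂, h₂⟩ :=
    steinWeiss_pointwise_far hv hv1 hu hu1 (by linarith) hlam (α := β) (β := α)
      (by linarith) hα
  obtain ⟨η₃, hη₃, C₃, hC₃, h₃⟩ : ∃ η > 0, ∃ C > 0, ∀ F G X Y Z : ℝ,
      0 ≤ F → 0 ≤ G → 0 < X → 0 < Y → 0 < Z → Z ≤ X + Y → X ≤ 2 * Y → Y ≤ 2 * X →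
      F ^ u * G ^ v * (X ^ (-α) * Y ^ (-β) * Z ^ (-lam)) ≤ C * majorant N η F G X Y Z := by
    rcases hab.eq_or_lt with h | h
    · obtain ⟨η, hη, C, hC, H⟩ :=
        steinWeiss_pointwise_near_of_eq hN hu hu1 hv hv1 hlamN h.symm hbal
      exact ⟨η, hη, C, hC, fun F G X Y Z hF hG hX hY hZ _ => H F G X Y Z hF hG hX hY hZ⟩
    · exact steinWeiss_pointwise_near_of_pos hu hu1 hv hv1 huv h hbal
  refine ⟨min η₁ (min η₂ η₃), lt_min hη₁ (lt_min hη₂ hη₃), C₁ + C₂ + C₃, by positivity,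
    fun F G X Y Z hF hG hX hY hZ hZXY hXYZ hYXZ => ?_⟩
  set η := min η₁ (min η₂ η₃)
  have anti {η' C' : ℝ} (hC' : 0 < C') (hCle : C' ≤ C₁ + C₂ + C₃) (h : η ≤ η') :
      C' * majorant N η' F G X Y Z ≤ (C₁ + C₂ + C₃) * majorant N η F G X Y Z :=
    mul_le_mul hCle (majorant_antitone hN hF hG hX hY hZ h)
      (majorant_nonneg hF hG hX hY hZ) (by positivity)
  by_cases hYX : 2 * Y ≤ X
  · exact (h₁ F G X Y Z hF hG hX hY hZ hXYZ hYX).trans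
      (anti hC₁ (by linarith) (min_le_left _ _))
  by_cases hXY : 2 * X ≤ Y
  · have h := h₂ G F Y X Z hG hF hY hX hZ hYXZ hXY
    rw [← majorant_swap, mul_comm (G ^ v), mul_comm (Y ^ (-β))] at h
    exact h.trans (anti hC₂ (by linarith) ((min_le_right _ _).trans (min_le_left _ _)))
  · exact (h₃ F G X Y Z hF hG hX hY hZ hZXY (by linarith) (by linarith)).trans
      (anti hC₃ (by linarith) ((min_le_right _ _).trans (min_le_right _ _)))

/-- A sum of three dilated profiles in the shape in which they occur in `majorant`. -/
def profileSum {E : Type*} [NormedAddCommGroup E] (N η : ℝ) (F : E → ℝ) (x y : E) : ℝ :=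
  dilatedProfile N η ‖x‖⁻¹ ‖y‖ + dilatedProfile N η ‖x‖⁻¹ ‖x - y‖
    + dilatedProfile N η (F x ^ N⁻¹) ‖x - y‖

lemma profileSum_nonneg {E : Type*} [NormedAddCommGroup E] (N η : ℝ) {F : E → ℝ} {x : E}
    (hF : 0 ≤ F x) (y : E) : 0 ≤ profileSum N η F x y := by
  have h {c r : ℝ} (hc : 0 ≤ c) (hr : 0 ≤ r) := dilatedProfile_nonneg (N := N) (η := η) hc hr
  have h1 := h (inv_nonneg.2 (norm_nonneg x)) (norm_nonneg y)
  have h2 := h (inv_nonneg.2 (norm_nonneg x)) (norm_nonneg (x - y))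
  have h3 := h (Real.rpow_nonneg hF N⁻¹) (norm_nonneg (x - y))
  unfold profileSum
  positivity

lemma majorant_eq {E : Type*} [NormedAddCommGroup E] (N η : ℝ) (F G : E → ℝ) (x y : E) :
    majorant N η (F x) (G y) ‖x‖ ‖y‖ ‖x - y‖
      = F x * G y + F x * profileSum N η F x y + G y * profileSum N η G y x := by
  rw [majorant, profileSum, profileSum, norm_sub_rev y x]

section Integrals

variable {E : Type*} [NormedAddCommGroup E] [NormedSpace ℝ E] [FiniteDimensional ℝ E]
  [MeasurableSpace E] [BorelSpace E] (μ : Measure E) [μ.IsAddHaarMeasure]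

open Module in
lemma integrable_radialProfile_norm [Nontrivial E] {η : ℝ} (hη : 0 < η) :
    Integrable (fun x : E => radialProfile (finrank ℝ E) η ‖x‖) μ := by
  rw [integrable_fun_norm_addHaar μ (f := radialProfile (finrank ℝ E) η)]
  have hd : 1 ≤ finrank ℝ E := finrank_pos
  have hpow {y : ℝ} (hy : 0 < y) : y ^ (finrank ℝ E - 1) = y ^ ((finrank ℝ E : ℝ) - 1) := by
    rw [← Real.rpow_natCast, Nat.cast_sub hd, Nat.cast_one]
  rw [← Set.Ioo_union_Ici_eq_Ioi one_pos, integrableOn_union]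
  constructor
  · refine ((intervalIntegral.integrableOn_Ioo_rpow_iff (s := η - 1) one_pos).2
      (by linarith)).congr_fun (fun y hy => ?_) measurableSet_Ioo
    simp only [radialProfile, if_pos hy.2, smul_eq_mul, hpow hy.1]
    rw [← Real.rpow_add hy.1]; ring_nf
  · rw [integrableOn_Ici_iff_integrableOn_Ioi]
    refine (integrableOn_Ioi_rpow_of_lt (a := -1 - η) (by linarith) one_pos).congr_fun
      (fun y hy => ?_) measurableSet_Ioi
    have hy1 : (1 : ℝ) < y := hy
    have hy0 : 0 < y := one_pos.trans hy1
    simp only [radialProfile, if_neg hy1.not_gt, smul_eq_mul, hpow hy0]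
    rw [← Real.rpow_add hy0]; ring_nf

open Module in
lemma lintegral_dilatedProfile_norm_le [Nontrivial E] (η : ℝ) {c : ℝ} (hc : 0 ≤ c) :
    ∫⁻ x : E, ENNReal.ofReal (dilatedProfile (finrank ℝ E) η c ‖x‖) ∂μ
      ≤ ∫⁻ x : E, ENNReal.ofReal (radialProfile (finrank ℝ E) η ‖x‖) ∂μ := by
  have hd : (0 : ℝ) < finrank ℝ E := by exact_mod_cast finrank_pos
  rcases hc.eq_or_lt with rfl | hc
  · simp [dilatedProfile, Real.zero_rpow hd.ne']
  have hm : Measurable fun x : E => ENNReal.ofReal (radialProfile (finrank ℝ E) η ‖x‖) := by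
    fun_prop
  have h1 : ∫⁻ x : E, ENNReal.ofReal (radialProfile (finrank ℝ E) η ‖c • x‖) ∂μ
      = ENNReal.ofReal (c ^ finrank ℝ E)⁻¹
        * ∫⁻ x : E, ENNReal.ofReal (radialProfile (finrank ℝ E) η ‖x‖) ∂μ := by
    rw [← lintegral_map hm (measurable_const_smul c), Measure.map_addHaar_smul μ hc.ne',
      lintegral_smul_measure, abs_of_pos (by positivity), smul_eq_mul]
  have h2 (x : E) : ENNReal.ofReal (dilatedProfile (finrank ℝ E) η c ‖x‖)
      = ENNReal.ofReal (c ^ finrank ℝ E)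
        * ENNReal.ofReal (radialProfile (finrank ℝ E) η ‖c • x‖) := by
    rw [← ENNReal.ofReal_mul (by positivity), dilatedProfile, norm_smul, Real.norm_of_nonneg hc.le,
      Real.rpow_natCast]
  simp_rw [h2]
  rw [lintegral_const_mul' _ _ ENNReal.ofReal_ne_top, h1, ← mul_assoc,
    ← ENNReal.ofReal_mul (by positivity), mul_inv_cancel₀ (by positivity), ENNReal.ofReal_one,
    one_mul]

lemma measurable_dilatedProfile_comp {δ : Type*} [MeasurableSpace δ] (N η : ℝ) {c r : δ → ℝ}
    (hc : Measurable c) (hr : Measurable r) :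
    Measurable fun a => dilatedProfile N η (c a) (r a) := by
  unfold dilatedProfile
  fun_prop

lemma measurable_profileSum (N η : ℝ) {F : E → ℝ} (hF : Measurable F) :
    Measurable (Function.uncurry (profileSum N η F)) := by
  unfold Function.uncurry profileSum
  refine ((measurable_dilatedProfile_comp _ _ ?_ ?_).add
    (measurable_dilatedProfile_comp _ _ ?_ ?_)).add (measurable_dilatedProfile_comp _ _ ?_ ?_) <;>
  fun_prop

open Module in
lemma lintegral_profileSum_le [Nontrivial E] (η : ℝ) {F : E → ℝ} {x : E} (hF : 0 ≤ F x) :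
    ∫⁻ y, ENNReal.ofReal (profileSum (finrank ℝ E) η F x y) ∂μ
      ≤ 3 * ∫⁻ y : E, ENNReal.ofReal (radialProfile (finrank ℝ E) η ‖y‖) ∂μ := by
  set N := (finrank ℝ E : ℝ)
  set M := ∫⁻ y : E, ENNReal.ofReal (radialProfile N η ‖y‖) ∂μ
  have shift {c : ℝ} (hc : 0 ≤ c) :
      ∫⁻ y, ENNReal.ofReal (dilatedProfile N η c ‖x - y‖) ∂μ ≤ M := by
    rw [lintegral_sub_left_eq_self (fun z => ENNReal.ofReal (dilatedProfile N η c ‖z‖))]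
    exact lintegral_dilatedProfile_norm_le μ η hc
  have hm {c : ℝ} {r : E → ℝ} (hr : Measurable r) :
      Measurable fun y => ENNReal.ofReal (dilatedProfile N η c (r y)) :=
    (measurable_dilatedProfile_comp N η measurable_const hr).ennreal_ofReal
  calc ∫⁻ y, ENNReal.ofReal (profileSum N η F x y) ∂μ
      ≤ ∫⁻ y, (ENNReal.ofReal (dilatedProfile N η ‖x‖⁻¹ ‖y‖)
          + ENNReal.ofReal (dilatedProfile N η ‖x‖⁻¹ ‖x - y‖)
          + ENNReal.ofReal (dilatedProfile N η (F x ^ N⁻¹) ‖x - y‖)) ∂μ :=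
        lintegral_mono fun y =>
          ENNReal.ofReal_add_le.trans (add_le_add_left ENNReal.ofReal_add_le _)
    _ = ∫⁻ y, ENNReal.ofReal (dilatedProfile N η ‖x‖⁻¹ ‖y‖) ∂μ
          + ∫⁻ y, ENNReal.ofReal (dilatedProfile N η ‖x‖⁻¹ ‖x - y‖) ∂μ
          + ∫⁻ y, ENNReal.ofReal (dilatedProfile N η (F x ^ N⁻¹) ‖x - y‖) ∂μ := by
        rw [lintegral_add_right _ (hm (by fun_prop)), lintegral_add_right _ (hm (by fun_prop))]
    _ ≤ M + M + M := by
        gcongr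
        · exact lintegral_dilatedProfile_norm_le μ η (by positivity)
        · exact shift (by positivity)
        · exact shift (by positivity)
    _ = 3 * M := by ring

open Module in
lemma lintegral_lintegral_majorant_le [Nontrivial E] (η : ℝ) {F G : E → ℝ} (hF : 0 ≤ F)
    (hG : 0 ≤ G) (hFm : Measurable F) (hGm : Measurable G)
    (hF1 : ∫⁻ x, ENNReal.ofReal (F x) ∂μ ≤ 1) (hG1 : ∫⁻ x, ENNReal.ofReal (G x) ∂μ ≤ 1) :
    ∫⁻ x, ∫⁻ y, ENNReal.ofReal
        (majorant (finrank ℝ E) η (F x) (G y) ‖x‖ ‖y‖ ‖x - y‖) ∂μ ∂μ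
      ≤ 1 + 2 * (3 * ∫⁻ y : E, ENNReal.ofReal (radialProfile (finrank ℝ E) η ‖y‖) ∂μ) := by
  set N := (finrank ℝ E : ℝ)
  set M := 3 * ∫⁻ y : E, ENNReal.ofReal (radialProfile N η ‖y‖) ∂μ
  have weighted {H : E → ℝ} (hH : 0 ≤ H) (hH1 : ∫⁻ x, ENNReal.ofReal (H x) ∂μ ≤ 1) :
      ∫⁻ x, ∫⁻ y, ENNReal.ofReal (H x) * ENNReal.ofReal (profileSum N η H x y) ∂μ ∂μ ≤ M :=
    calc _ ≤ ∫⁻ x, ENNReal.ofReal (H x) * M ∂μ := by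
          refine lintegral_mono fun x => ?_
          rw [lintegral_const_mul' _ _ ENNReal.ofReal_ne_top]
          gcongr
          exact lintegral_profileSum_le μ η (hH x)
      _ ≤ M := by
          by_cases hMt : M = ⊤
          · simp [hMt]
          rw [lintegral_mul_const' _ _ hMt]
          exact mul_le_of_le_one_left' hH1
  have mF : Measurable fun z : E × E =>
      ENNReal.ofReal (F z.1) * ENNReal.ofReal (profileSum N η F z.1 z.2) :=
    (hFm.comp measurable_fst).ennreal_ofReal.mul (measurable_profileSum N η hFm).ennreal_ofReal
  have mG : Measurable fun z : E × E =>
      ENNReal.ofReal (G z.2) * ENNReal.ofReal (profileSum N η G z.2 z.1) :=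
    (hGm.comp measurable_snd).ennreal_ofReal.mul
      ((measurable_profileSum N η hGm).comp measurable_swap).ennreal_ofReal
  have pointwise (x y : E) :
      ENNReal.ofReal (majorant N η (F x) (G y) ‖x‖ ‖y‖ ‖x - y‖)
        = ENNReal.ofReal (F x) * ENNReal.ofReal (G y)
          + ENNReal.ofReal (F x) * ENNReal.ofReal (profileSum N η F x y)
          + ENNReal.ofReal (G y) * ENNReal.ofReal (profileSum N η G y x) := by
    have h1 := profileSum_nonneg N η (hF x) y
    have h2 := profileSum_nonneg N η (hG y) x
    have hFx := hF x
    have hGy := hG y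
    simp only [Pi.zero_apply] at hFx hGy
    rw [majorant_eq, ENNReal.ofReal_add (by positivity) (by positivity),
      ENNReal.ofReal_add (by positivity) (by positivity), ENNReal.ofReal_mul hFx,
      ENNReal.ofReal_mul hFx, ENNReal.ofReal_mul hGy]
  simp_rw [pointwise]
  calc _ = ∫⁻ x, ((∫⁻ y, ENNReal.ofReal (F x) * ENNReal.ofReal (G y) ∂μ)
          + (∫⁻ y, ENNReal.ofReal (F x) * ENNReal.ofReal (profileSum N η F x y) ∂μ)
          + ∫⁻ y, ENNReal.ofReal (G y) * ENNReal.ofReal (profileSum N η G y x) ∂μ) ∂μ := by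
        refine lintegral_congr fun x => ?_
        have mFx : Measurable fun y =>
            ENNReal.ofReal (F x) * ENNReal.ofReal (profileSum N η F x y) :=
          mF.comp measurable_prodMk_left
        have mGx : Measurable fun y =>
            ENNReal.ofReal (G y) * ENNReal.ofReal (profileSum N η G y x) :=
          mG.comp measurable_prodMk_left
        rw [lintegral_add_right _ mGx, lintegral_add_right _ mFx]
    _ = (∫⁻ x, ∫⁻ y, ENNReal.ofReal (F x) * ENNReal.ofReal (G y) ∂μ ∂μ)
          + (∫⁻ x, ∫⁻ y, ENNReal.ofReal (F x) * ENNReal.ofReal (profileSum N η F x y) ∂μ ∂μ)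
          + ∫⁻ x, ∫⁻ y, ENNReal.ofReal (G y) * ENNReal.ofReal (profileSum N η G y x) ∂μ ∂μ := by
        have mF' : Measurable fun x =>
            ∫⁻ y, ENNReal.ofReal (F x) * ENNReal.ofReal (profileSum N η F x y) ∂μ :=
          mF.lintegral_prod_right'
        have mG' : Measurable fun x =>
            ∫⁻ y, ENNReal.ofReal (G y) * ENNReal.ofReal (profileSum N η G y x) ∂μ :=
          mG.lintegral_prod_right'
        rw [lintegral_add_right _ mG', lintegral_add_right _ mF']
    _ ≤ 1 + M + M := by
        gcongr
        · rw [lintegral_lintegral_mul hFm.ennreal_ofReal.aemeasurable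
            hGm.ennreal_ofReal.aemeasurable]
          exact mul_le_one' hF1 hG1
        · exact weighted hF hF1
        · rw [lintegral_lintegral_swap mG.aemeasurable]
          exact weighted hG hG1
    _ = 1 + 2 * M := by ring

open Module in
/-- The Stein–Weiss inequality for the integrable powers of the two functions, normalized. -/
lemma steinWeiss_normalized [Nontrivial E] {u v lam α β : ℝ} (hu : 0 < u) (hu1 : u < 1)
    (hv : 0 < v) (hv1 : v < 1) (huv : 1 ≤ u + v) (hlam : 0 < lam) (hlamN : lam < finrank ℝ E)
    (hab : 0 ≤ α + β) (hbal : finrank ℝ E * (u + v) + (lam + α + β) = 2 * finrank ℝ E)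
    (hβ : β < finrank ℝ E * (1 - v)) (hα : α < finrank ℝ E * (1 - u)) :
    ∃ C : ℝ, 0 < C ∧ ∀ F G : E → ℝ, 0 ≤ F → 0 ≤ G → Measurable F → Measurable G →
      ∫⁻ x, ENNReal.ofReal (F x) ∂μ ≤ 1 → ∫⁻ x, ENNReal.ofReal (G x) ∂μ ≤ 1 →
      ∫⁻ x, ∫⁻ y, ENNReal.ofReal
        (F x ^ u * G y ^ v / (‖x‖ ^ α * ‖x - y‖ ^ lam * ‖y‖ ^ β)) ∂μ ∂μ ≤ ENNReal.ofReal C := by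
  have hN : (0 : ℝ) < finrank ℝ E := by exact_mod_cast finrank_pos
  obtain ⟨η, hη, C, hC, H⟩ := steinWeiss_pointwise hN hu hu1 hv hv1 huv hlam hlamN hab hbal hβ hα
  set M := ∫⁻ y : E, ENNReal.ofReal (radialProfile (finrank ℝ E) η ‖y‖) ∂μ
  have hMt : M ≠ ⊤ := (integrable_radialProfile_norm μ hη).lintegral_lt_top.ne
  refine ⟨C * (1 + 2 * (3 * M.toReal)), by positivity, fun F G hF hG hFm hGm hF1 hG1 => ?_⟩
  have hne (z : E) : ∀ᵐ x ∂μ, x ≠ z := by simp [ae_iff]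
  calc _ ≤ ∫⁻ x, ∫⁻ y, ENNReal.ofReal C * ENNReal.ofReal
          (majorant (finrank ℝ E) η (F x) (G y) ‖x‖ ‖y‖ ‖x - y‖) ∂μ ∂μ := by
        refine lintegral_mono_ae ((hne 0).mono fun x hx => lintegral_mono_ae ?_)
        filter_upwards [hne 0, hne x] with y hy hyx
        rw [← ENNReal.ofReal_mul hC.le]
        refine ENNReal.ofReal_le_ofReal ?_
        have h := H (F x) (G y) ‖x‖ ‖y‖ ‖x - y‖ (hF x) (hG y) (norm_pos_iff.2 hx)
          (norm_pos_iff.2 hy) (norm_pos_iff.2 (sub_ne_zero.2 hyx.symm)) (norm_sub_le x y)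
          (by simpa using norm_add_le y (x - y))
          (by simpa using norm_sub_le x (x - y))
        refine le_of_eq_of_le ?_ h
        rw [Real.rpow_neg (norm_nonneg _), Real.rpow_neg (norm_nonneg _),
          Real.rpow_neg (norm_nonneg _), div_eq_mul_inv, mul_inv, mul_inv]
        ring
    _ = ENNReal.ofReal C * ∫⁻ x, ∫⁻ y, ENNReal.ofReal
          (majorant (finrank ℝ E) η (F x) (G y) ‖x‖ ‖y‖ ‖x - y‖) ∂μ ∂μ := by
        simp_rw [lintegral_const_mul' _ _ ENNReal.ofReal_ne_top]
    _ ≤ ENNReal.ofReal C * (1 + 2 * (3 * M)) := by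
        gcongr
        exact lintegral_lintegral_majorant_le μ η hF hG hFm hGm hF1 hG1
    _ = ENNReal.ofReal (C * (1 + 2 * (3 * M.toReal))) := by
        rw [ENNReal.ofReal_mul hC.le, ENNReal.ofReal_add zero_le_one (by positivity),
          ENNReal.ofReal_mul zero_le_two, ENNReal.ofReal_mul (by norm_num),
          ENNReal.ofReal_toReal hMt]
        simp

end Integrals

lemma exists_normalized_power {E : Type*} [MeasurableSpace E] (μ : Measure E) {s : ℝ}
    (hs : 0 < s) {f : E → ℝ}
    (hf : MemLp f (ENNReal.ofReal s) μ) (hf0 : eLpNorm f (ENNReal.ofReal s) μ ≠ 0) :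
    ∃ F : E → ℝ, 0 ≤ F ∧ Measurable F ∧ ∫⁻ x, ENNReal.ofReal (F x) ∂μ ≤ 1 ∧
      ∀ᵐ x ∂μ, |f x| = (eLpNorm f (ENNReal.ofReal s) μ).toReal * F x ^ (1 / s) := by
  set L := (eLpNorm f (ENNReal.ofReal s) μ).toReal with hL
  have hLpos : 0 < L := ENNReal.toReal_pos hf0 hf.2.ne
  have hLe : ENNReal.ofReal L = eLpNorm f (ENNReal.ofReal s) μ := ENNReal.ofReal_toReal hf.2.ne
  have hf' : f =ᵐ[μ] hf.1.mk f := hf.1.ae_eq_mk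
  have hm : Measurable (hf.1.mk f) := hf.1.stronglyMeasurable_mk.measurable
  refine ⟨fun x => (|hf.1.mk f x| / L) ^ s, fun x => by positivity, by fun_prop, ?_, ?_⟩
  · have h1 : ∫⁻ x, ‖f x‖ₑ ^ s ∂μ = ENNReal.ofReal L ^ s := by
      rw [hLe, eLpNorm_eq_lintegral_rpow_enorm_toReal (by simpa using hs) ENNReal.ofReal_ne_top,
        ENNReal.toReal_ofReal hs.le, ← ENNReal.rpow_mul, one_div_mul_cancel hs.ne',
        ENNReal.rpow_one]
    have h2 : ∫⁻ x, ENNReal.ofReal ((|hf.1.mk f x| / L) ^ s) ∂μ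
        = ∫⁻ x, ‖f x‖ₑ ^ s * (ENNReal.ofReal L ^ s)⁻¹ ∂μ := by
      refine lintegral_congr_ae (hf'.mono fun x hx => ?_)
      simp only [← hx]
      rw [← ENNReal.ofReal_rpow_of_nonneg (by positivity) hs.le, ENNReal.ofReal_div_of_pos hLpos,
        ENNReal.div_rpow_of_nonneg _ _ hs.le, ← Real.enorm_eq_ofReal_abs, div_eq_mul_inv]
    have h3 : ENNReal.ofReal L ^ s ≠ 0 := by
      rw [ENNReal.ofReal_rpow_of_pos hLpos]; simpa using Real.rpow_pos_of_pos hLpos s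
    rw [h2, lintegral_mul_const' _ _ (ENNReal.inv_ne_top.2 h3), h1]
    exact ENNReal.mul_inv_le_one _
  · filter_upwards [hf'] with x hx
    rw [← hx, one_div, Real.rpow_rpow_inv (by positivity) hs.ne']
    field_simp

/-- **Stein–Weiss inequality on `ℝⁿ` with both weight exponents not necessarily nonnegative**
(Theorem 1.3, inequality part). -/
theorem stein_weiss_euclidean
    (n : ℕ) (hn : 1 ≤ n) (p p' q q' lam α β : ℝ)
    (hp : 1 < p) (hq' : 1 < q')
    (hq : 1 / q + 1 / q' = 1) (hp' : 1 / p + 1 / p' = 1)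
    (hlam0 : 0 < lam) (hlamn : lam < n)
    (hab : 0 ≤ α + β) (habn : lam + α + β ≤ n)
    (hβ : β < n / p') (hα : α < n / q)
    (hbal : 1 / p + 1 / q' + (lam + α + β) / n = 2) :
    ∃ C : ℝ, 0 < C ∧ ∀ f g : EuclideanSpace ℝ (Fin n) → ℝ,
      MemLp f (ENNReal.ofReal q') volume → MemLp g (ENNReal.ofReal p) volume →
      ∫⁻ x, ∫⁻ y, ENNReal.ofReal
          (|f x| * |g y| / (‖x‖ ^ α * ‖x - y‖ ^ lam * ‖y‖ ^ β)) ≤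
        ENNReal.ofReal C * eLpNorm f (ENNReal.ofReal q') volume *
          eLpNorm g (ENNReal.ofReal p) volume := by
  have : Nonempty (Fin n) := ⟨⟨0, hn⟩⟩
  have hn0 : (0 : ℝ) < n := by exact_mod_cast hn
  have hp0 : 0 < p := by linarith
  have hq'0 : 0 < q' := by linarith
  have hfin : Module.finrank ℝ (EuclideanSpace ℝ (Fin n)) = n := by simp
  rw [div_eq_mul_one_div, eq_sub_of_add_eq' hp'] at hβ
  rw [div_eq_mul_one_div, eq_sub_of_add_eq hq] at hα
  have hbal' : n * (1 / q' + 1 / p) + (lam + α + β) = 2 * n := by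
    rw [← hbal]; field_simp; ring
  have huv : 1 ≤ 1 / q' + 1 / p := by
    have : (lam + α + β) / n ≤ 1 := (div_le_one hn0).2 habn
    linarith
  obtain ⟨C, hC, H⟩ := steinWeiss_normalized
    (volume : Measure (EuclideanSpace ℝ (Fin n))) (u := 1 / q') (v := 1 / p)
    (by positivity) ((div_lt_one hq'0).2 hq') (by positivity) ((div_lt_one hp0).2 hp) huv hlam0
    (by rwa [hfin]) hab (by rwa [hfin]) (by rwa [hfin]) (by rwa [hfin])
  refine ⟨C, hC, fun f g hf hg => ?_⟩
  by_cases hf0 : eLpNorm f (ENNReal.ofReal q') volume = 0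
  · rw [eLpNorm_eq_zero_iff hf.1 (by simpa using hq'0)] at hf0
    refine le_of_eq_of_le ?_ zero_le
    rw [lintegral_eq_zero_of_ae_eq_zero]
    filter_upwards [hf0] with x hx
    simp [hx]
  by_cases hg0 : eLpNorm g (ENNReal.ofReal p) volume = 0
  · rw [eLpNorm_eq_zero_iff hg.1 (by simpa using hp0)] at hg0
    refine le_of_eq_of_le ?_ zero_le
    rw [lintegral_eq_zero_of_ae_eq_zero]
    refine Filter.Eventually.of_forall fun x => lintegral_eq_zero_of_ae_eq_zero ?_
    filter_upwards [hg0] with y hy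
    simp [hy]
  obtain ⟨F, hF, hFm, hF1, hFf⟩ := exists_normalized_power volume hq'0 hf hf0
  obtain ⟨G, hG, hGm, hG1, hGg⟩ := exists_normalized_power volume hp0 hg hg0
  set A := eLpNorm f (ENNReal.ofReal q') volume
  set B := eLpNorm g (ENNReal.ofReal p) volume
  have hAB : ENNReal.ofReal (A.toReal * B.toReal) = A * B := by
    rw [ENNReal.ofReal_mul ENNReal.toReal_nonneg, ENNReal.ofReal_toReal hf.2.ne,
      ENNReal.ofReal_toReal hg.2.ne]
  calc _ = ∫⁻ x, ∫⁻ y, ENNReal.ofReal (A.toReal * B.toReal) * ENNReal.ofReal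
          (F x ^ (1 / q') * G y ^ (1 / p) / (‖x‖ ^ α * ‖x - y‖ ^ lam * ‖y‖ ^ β)) := by
        refine lintegral_congr_ae (hFf.mono fun x hx =>
          lintegral_congr_ae (hGg.mono fun y hy => ?_))
        simp only [hx, hy]
        rw [← ENNReal.ofReal_mul (by positivity)]
        ring_nf
    _ = A * B * ∫⁻ x, ∫⁻ y, ENNReal.ofReal
          (F x ^ (1 / q') * G y ^ (1 / p) / (‖x‖ ^ α * ‖x - y‖ ^ lam * ‖y‖ ^ β)) := by
        simp_rw [lintegral_const_mul' _ _ ENNReal.ofReal_ne_top, hAB]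
    _ ≤ A * B * ENNReal.ofReal C := by
        gcongr
        exact H F G hF hG hFm hGm hF1 hG1
    _ = ENNReal.ofReal C * A * B := by ring
end
end

section
/- Let n, m ≥ 1 and suppose 1 < p < ∞, 1 < q' < ∞, q is the Hölder conjugate of q' (1/q + 1/q' = 1), p' is the Hölder conjugate of p, 0 < λ < n, α + β ≥ 0, λ + α + β ≤ n + m, β < m/p', α < m/q, and 1/p + 1/q' + (λ+α+β)/(n+m) = 2. Then there exists a constant C_{n,m,α,β,p,q'} > 0 such that for all f ∈ L^{q'}(ℝ^{n+m}) and g ∈ L^{p}(ℝ^{n+m}), ∫_{ℝ^{n+m}}∫_{ℝ^{n+m}} |f(x)| |g(y)| / (|x'|^{α} |x−y|^{λ} |y'|^{β}) dx dy ≤ C_{n,m,α,β,p,q'} ‖f‖_{L^{q'}(ℝ^{n+m})} ‖g‖_{L^{p}(ℝ^{n+m})}, where x = (x', x'') and y = (y', y'') with x', y' ∈ ℝ^m and x'', y'' ∈ ℝⁿ. -/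
open MeasureTheory ENNReal Filter

noncomputable section

/-- `ℝ^{n+m}` split as `ℝ^m × ℝⁿ`, points written `x = (x', x'')`. -/
abbrev Rsplit (m n : ℕ) := (Fin m → ℝ) × (Fin n → ℝ)

/-- Euclidean norm on `ℝ^k`. -/
def eunorm {k : ℕ} (x : Fin k → ℝ) : ℝ := Real.sqrt (∑ j, x j ^ 2)

/-- Euclidean norm of `x = (x', x'') ∈ ℝ^m × ℝⁿ` as a point of `ℝ^{n+m}`. -/
def pnorm {m n : ℕ} (x : Rsplit m n) : ℝ := Real.sqrt (eunorm x.1 ^ 2 + eunorm x.2 ^ 2)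

lemma pow_pred_mul_rpow {d : ℕ} (hd : 1 ≤ d) {y : ℝ} (hy : 0 < y) (κ : ℝ) :
    y ^ (d - 1) * y ^ (-κ) = y ^ ((d : ℝ) - κ - 1) := by
  rw [← Real.rpow_natCast, ← Real.rpow_add hy]
  congr 1
  push_cast [Nat.cast_sub hd]
  ring

section Radial

variable {E : Type*} [NormedAddCommGroup E] [NormedSpace ℝ E] [Nontrivial E]
  [FiniteDimensional ℝ E] [MeasurableSpace E] [BorelSpace E]

lemma lintegral_radial_le (μ : Measure E) [μ.IsAddHaarMeasure] {f : ℝ → ℝ} (hf : ∀ t, 0 ≤ f t)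
    (hfi : IntegrableOn (fun y : ℝ => y ^ (Module.finrank ℝ E - 1) * f y) (Set.Ioi 0)) :
    ∫⁻ x, ENNReal.ofReal (f ‖x‖) ∂μ = ENNReal.ofReal (Module.finrank ℝ E * μ.real (Metric.ball 0 1) *
      ∫ y in Set.Ioi (0 : ℝ), y ^ (Module.finrank ℝ E - 1) * f y) := by
  have h1 : Integrable (fun x : E => f ‖x‖) μ := by
    rw [integrable_fun_norm_addHaar μ]
    simpa [smul_eq_mul] using hfi
  rw [← ofReal_integral_eq_lintegral_ofReal h1 (Eventually.of_forall fun x => hf _),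
    integral_fun_norm_addHaar μ f]
  simp [smul_eq_mul, mul_assoc]

/-- Near the origin, `‖x‖ ^ (-κ)` is integrable on balls when `κ` is below the dimension. -/
lemma exists_lintegral_rpow_norm_le_inside (μ : Measure E) [μ.IsAddHaarMeasure] {κ : ℝ}
    (hκ : κ < Module.finrank ℝ E) :
    ∃ C : ℝ, 0 ≤ C ∧ ∀ R : ℝ, 0 < R →
      ∫⁻ x, ENNReal.ofReal (if ‖x‖ ≤ R then ‖x‖ ^ (-κ) else 0) ∂μ ≤
        ENNReal.ofReal (C * R ^ ((Module.finrank ℝ E : ℝ) - κ)) := by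
  set d := Module.finrank ℝ E
  refine ⟨d * μ.real (Metric.ball 0 1) * (1 / (d - κ)), ?_, fun R hR => ?_⟩
  · have : 0 < (d : ℝ) - κ := by linarith
    positivity
  have hind : Set.EqOn ((Set.Ioc 0 R).indicator fun y : ℝ => y ^ ((d : ℝ) - κ - 1))
      (fun y : ℝ => y ^ (d - 1) * (if y ≤ R then |y| ^ (-κ) else 0)) (Set.Ioi 0) := by
    intro y hy
    have hy : 0 < y := hy
    by_cases h : y ≤ R
    · simp only [Set.indicator, Set.mem_Ioc, hy, h, and_self, if_true, abs_of_pos hy]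
      exact (pow_pred_mul_rpow Module.finrank_pos hy κ).symm
    · simp [Set.indicator, h]
  have hio : IntegrableOn (fun y : ℝ => y ^ ((d : ℝ) - κ - 1)) (Set.Ioc 0 R) := by
    rw [← intervalIntegrable_iff_integrableOn_Ioc_of_le hR.le]
    exact intervalIntegral.intervalIntegrable_rpow' (by linarith)
  have key := lintegral_radial_le μ (f := fun y => if y ≤ R then |y| ^ (-κ) else 0)
    (fun t => by split_ifs <;> positivity) ?_
  · simp only [abs_norm] at key
    rw [key]
    apply le_of_eq
    congr 1
    rw [← setIntegral_congr_fun measurableSet_Ioi hind, setIntegral_indicator measurableSet_Ioc,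
      Set.inter_eq_right.2 (fun y hy => hy.1), ← intervalIntegral.integral_of_le hR.le,
      integral_rpow (Or.inl (by linarith))]
    have : (d : ℝ) - κ ≠ 0 := by linarith
    rw [sub_add_cancel, Real.zero_rpow this]
    ring
  · refine IntegrableOn.congr_fun ?_ hind measurableSet_Ioi
    exact (hio.integrable_indicator measurableSet_Ioc).integrableOn

/-- Away from the origin, `‖x‖ ^ (-κ)` is integrable when `κ` exceeds the dimension. -/
lemma exists_lintegral_rpow_norm_le_outside (μ : Measure E) [μ.IsAddHaarMeasure] {κ : ℝ}
    (hκ : Module.finrank ℝ E < κ) :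
    ∃ C : ℝ, 0 ≤ C ∧ ∀ R : ℝ, 0 < R →
      ∫⁻ x, ENNReal.ofReal (if R < ‖x‖ then ‖x‖ ^ (-κ) else 0) ∂μ ≤
        ENNReal.ofReal (C * R ^ ((Module.finrank ℝ E : ℝ) - κ)) := by
  set d := Module.finrank ℝ E
  refine ⟨d * μ.real (Metric.ball 0 1) * (1 / (κ - d)), ?_, fun R hR => ?_⟩
  · have : 0 < κ - (d : ℝ) := by linarith
    positivity
  have hind : Set.EqOn ((Set.Ioi R).indicator fun y : ℝ => y ^ ((d : ℝ) - κ - 1))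
      (fun y : ℝ => y ^ (d - 1) * (if R < y then |y| ^ (-κ) else 0)) (Set.Ioi 0) := by
    intro y hy
    have hy : 0 < y := hy
    by_cases h : R < y
    · simp only [Set.indicator, Set.mem_Ioi, h, if_true, abs_of_pos hy]
      exact (pow_pred_mul_rpow Module.finrank_pos hy κ).symm
    · simp [Set.indicator, h]
  have hio : IntegrableOn (fun y : ℝ => y ^ ((d : ℝ) - κ - 1)) (Set.Ioi R) :=
    integrableOn_Ioi_rpow_of_lt (by linarith) hR
  have key := lintegral_radial_le μ (f := fun y => if R < y then |y| ^ (-κ) else 0)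
    (fun t => by split_ifs <;> positivity) ?_
  · simp only [abs_norm] at key
    rw [key]
    apply le_of_eq
    congr 1
    rw [← setIntegral_congr_fun measurableSet_Ioi hind, setIntegral_indicator measurableSet_Ioi,
      Set.inter_eq_right.2 (Set.Ioi_subset_Ioi hR.le),
      integral_Ioi_rpow_of_lt (by linarith) hR, sub_add_cancel]
    have h1 : (d : ℝ) - κ ≠ 0 := by linarith
    have h2 : κ - (d : ℝ) ≠ 0 := by linarith
    field_simp
    ring
  · refine IntegrableOn.congr_fun ?_ hind measurableSet_Ioi
    exact (hio.integrable_indicator measurableSet_Ioi).integrableOn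

/-- The integral of `max ρ ‖a - z‖ ^ (-M)` scales like `ρ ^ (d - M)`. -/
lemma exists_lintegral_rpow_max_norm_le (μ : Measure E) [μ.IsAddHaarMeasure] {M : ℝ}
    (hM : Module.finrank ℝ E < M) :
    ∃ C : ℝ, 0 ≤ C ∧ ∀ (a : E) (ρ : ℝ), 0 < ρ →
      ∫⁻ z, ENNReal.ofReal (max ρ ‖a - z‖ ^ (-M)) ∂μ ≤
        ENNReal.ofReal (C * ρ ^ ((Module.finrank ℝ E : ℝ) - M)) := by
  have hd : (0 : ℝ) < Module.finrank ℝ E := by exact_mod_cast Module.finrank_pos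
  obtain ⟨C₁, hC₁, h₁⟩ := exists_lintegral_rpow_norm_le_inside μ (κ := 0) hd
  obtain ⟨C₂, hC₂, h₂⟩ := exists_lintegral_rpow_norm_le_outside μ hM
  refine ⟨C₁ + C₂, by positivity, fun a ρ hρ => ?_⟩
  rw [lintegral_sub_left_eq_self (fun z => ENNReal.ofReal (max ρ ‖z‖ ^ (-M))) a]
  have hpt : ∀ z : E, ENNReal.ofReal (max ρ ‖z‖ ^ (-M)) ≤
      ENNReal.ofReal (ρ ^ (-M)) * ENNReal.ofReal (if ‖z‖ ≤ ρ then ‖z‖ ^ (-(0:ℝ)) else 0) +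
        ENNReal.ofReal (if ρ < ‖z‖ then ‖z‖ ^ (-M) else 0) := by
    intro z
    by_cases h : ‖z‖ ≤ ρ
    · simp [h]
    · have h' : ρ < ‖z‖ := not_le.1 h
      simp [h, h', h'.le]
  refine (lintegral_mono hpt).trans ?_
  have hmeas : Measurable fun z : E => ENNReal.ofReal (if ρ < ‖z‖ then ‖z‖ ^ (-M) else 0) :=
    (Measurable.ite (measurableSet_lt measurable_const measurable_norm) (by fun_prop)
      measurable_const).ennreal_ofReal
  rw [lintegral_add_right _ hmeas, lintegral_const_mul' _ _ ENNReal.ofReal_ne_top]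
  grw [h₁ ρ hρ, h₂ ρ hρ]
  rw [← ENNReal.ofReal_mul (by positivity), ← ENNReal.ofReal_add (by positivity) (by positivity)]
  apply le_of_eq
  congr 1
  rw [mul_left_comm, ← Real.rpow_add hρ]
  ring_nf

end Radial

section BilinearForm

variable {Ω : Type*} [MeasurableSpace Ω]

/-- The bilinear form with kernel `w` is bounded on `L^{1/a} × L^{1/b}`, expressed through the
densities `u = |f|^{1/a}` and `v = |g|^{1/b}`. -/
def BoundedForm (μ : Measure Ω) (a b : ℝ) (w : Ω → Ω → ℝ) : Prop :=
  ∃ C : ℝ, 0 ≤ C ∧ ∀ u v : Ω → ℝ, Measurable u → Measurable v → (∀ x, 0 ≤ u x) → (∀ x, 0 ≤ v x) →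
    ∫⁻ x, ENNReal.ofReal (u x) ∂μ ≤ 1 → ∫⁻ x, ENNReal.ofReal (v x) ∂μ ≤ 1 →
    ∫⁻ x, ∫⁻ y, ENNReal.ofReal (u x ^ a * v y ^ b * w x y) ∂μ ∂μ ≤ ENNReal.ofReal C

variable {μ : Measure Ω} {a b : ℝ}

lemma lintegral_lintegral_le_of_kernel_bounds [SFinite μ] {u v : Ω → ℝ} {F κ₁ κ₂ : Ω → Ω → ℝ}
    {C₁ C₂ : ℝ} (hu : Measurable u) (hv : Measurable v) (hu0 : ∀ x, 0 ≤ u x) (hv0 : ∀ x, 0 ≤ v x)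
    (hu1 : ∫⁻ x, ENNReal.ofReal (u x) ∂μ ≤ 1) (hv1 : ∫⁻ x, ENNReal.ofReal (v x) ∂μ ≤ 1)
    (hκ₁ : Measurable (Function.uncurry κ₁)) (hκ₂ : Measurable (Function.uncurry κ₂))
    (hC₁ : 0 ≤ C₁) (hC₂ : 0 ≤ C₂)
    (hF : ∀ᵐ x ∂μ, ∀ᵐ y ∂μ, F x y ≤ u x * v y + u x * κ₁ x y + v y * κ₂ x y)
    (h₁ : ∀ᵐ x ∂μ, ∫⁻ y, ENNReal.ofReal (κ₁ x y) ∂μ ≤ ENNReal.ofReal C₁)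
    (h₂ : ∀ᵐ y ∂μ, ∫⁻ x, ENNReal.ofReal (κ₂ x y) ∂μ ≤ ENNReal.ofReal C₂) :
    ∫⁻ x, ∫⁻ y, ENNReal.ofReal (F x y) ∂μ ∂μ ≤ ENNReal.ofReal (1 + C₁ + C₂) := by
  have hκ₁' : ∀ x, Measurable fun y => κ₁ x y := fun x => hκ₁.comp measurable_prodMk_left
  have hκ₂' : ∀ x, Measurable fun y => κ₂ x y := fun x => hκ₂.comp measurable_prodMk_left
  have hκ₂'' : ∀ y, Measurable fun x => κ₂ x y := fun y => hκ₂.comp measurable_prodMk_right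
  have hm₁ : Measurable fun x => ∫⁻ y, ENNReal.ofReal (u x) * ENNReal.ofReal (κ₁ x y) ∂μ :=
    Measurable.lintegral_prod_right'
      (f := fun z : Ω × Ω => ENNReal.ofReal (u z.1) * ENNReal.ofReal (κ₁ z.1 z.2))
      ((hu.comp measurable_fst).ennreal_ofReal.mul hκ₁.ennreal_ofReal)
  have hm₀ : Measurable fun x => ∫⁻ y, ENNReal.ofReal (u x) * ENNReal.ofReal (v y) ∂μ :=
    Measurable.lintegral_prod_right'
      (f := fun z : Ω × Ω => ENNReal.ofReal (u z.1) * ENNReal.ofReal (v z.2))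
      ((hu.comp measurable_fst).ennreal_ofReal.mul (hv.comp measurable_snd).ennreal_ofReal)
  have step : ∀ᵐ x ∂μ, ∫⁻ y, ENNReal.ofReal (F x y) ∂μ ≤
      ∫⁻ y, ENNReal.ofReal (u x) * ENNReal.ofReal (v y) ∂μ +
      ∫⁻ y, ENNReal.ofReal (u x) * ENNReal.ofReal (κ₁ x y) ∂μ +
      ∫⁻ y, ENNReal.ofReal (v y) * ENNReal.ofReal (κ₂ x y) ∂μ := by
    filter_upwards [hF] with x hx
    rw [← lintegral_add_left (by fun_prop), ← lintegral_add_left (by fun_prop)]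
    refine lintegral_mono_ae ?_
    filter_upwards [hx] with y hy
    refine (ENNReal.ofReal_le_ofReal hy).trans ?_
    refine ENNReal.ofReal_add_le.trans ?_
    rw [ENNReal.ofReal_mul (hv0 y)]
    gcongr
    refine ENNReal.ofReal_add_le.trans ?_
    rw [ENNReal.ofReal_mul (hu0 x), ENNReal.ofReal_mul (hu0 x)]
  refine (lintegral_mono_ae step).trans ?_
  rw [lintegral_add_left (by exact hm₀.add hm₁), lintegral_add_left hm₀,
    ENNReal.ofReal_add (by positivity) hC₂, ENNReal.ofReal_add zero_le_one hC₁,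
    ENNReal.ofReal_one]
  gcongr
  · simp_rw [lintegral_const_mul _ hv.ennreal_ofReal]
    rw [lintegral_mul_const _ hu.ennreal_ofReal]
    exact mul_le_one' hu1 hv1
  · simp_rw [fun x => lintegral_const_mul (ENNReal.ofReal (u x)) (hκ₁' x).ennreal_ofReal (μ := μ)]
    calc ∫⁻ x, ENNReal.ofReal (u x) * ∫⁻ y, ENNReal.ofReal (κ₁ x y) ∂μ ∂μ
        ≤ ∫⁻ x, ENNReal.ofReal (u x) * ENNReal.ofReal C₁ ∂μ :=
          lintegral_mono_ae (h₁.mono fun x hx => by gcongr)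
      _ = (∫⁻ x, ENNReal.ofReal (u x) ∂μ) * ENNReal.ofReal C₁ :=
          lintegral_mul_const _ hu.ennreal_ofReal
      _ ≤ 1 * ENNReal.ofReal C₁ := by gcongr
      _ = _ := one_mul _
  · rw [lintegral_lintegral_swap
      (((hv.comp measurable_snd).ennreal_ofReal.mul hκ₂.ennreal_ofReal).aemeasurable)]
    simp_rw [fun y => lintegral_const_mul (ENNReal.ofReal (v y)) (hκ₂'' y).ennreal_ofReal (μ := μ)]
    calc ∫⁻ y, ENNReal.ofReal (v y) * ∫⁻ x, ENNReal.ofReal (κ₂ x y) ∂μ ∂μ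
        ≤ ∫⁻ y, ENNReal.ofReal (v y) * ENNReal.ofReal C₂ ∂μ :=
          lintegral_mono_ae (h₂.mono fun x hx => by gcongr)
      _ = (∫⁻ x, ENNReal.ofReal (v x) ∂μ) * ENNReal.ofReal C₂ :=
          lintegral_mul_const _ hv.ennreal_ofReal
      _ ≤ 1 * ENNReal.ofReal C₂ := by gcongr
      _ = _ := one_mul _

/-- The weighted arithmetic-geometric mean inequality behind Young's convolution inequality. -/
lemma rpow_mul_rpow_mul_le_add {u v k₁ k₂ : ℝ} (hu : 0 ≤ u) (hv : 0 ≤ v) (hk₁ : 0 ≤ k₁)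
    (hk₂ : 0 ≤ k₂) (ha : a ≤ 1) (hb : b ≤ 1) (hab : 1 ≤ a + b) :
    u ^ a * v ^ b * (k₁ ^ (1 - b) * k₂ ^ (1 - a)) ≤ u * v + u * k₁ + v * k₂ := by
  have h := Real.geom_mean_le_arith_mean3_weighted (w₁ := a + b - 1) (w₂ := 1 - b) (w₃ := 1 - a)
    (p₁ := u * v) (p₂ := u * k₁) (p₃ := v * k₂) (by linarith) (by linarith) (by linarith)
    (by positivity) (by positivity) (by positivity) (by ring)
  have hu' : u ^ a = u ^ (a + b - 1) * u ^ (1 - b) := by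
    rw [← Real.rpow_add_of_nonneg hu (by linarith) (by linarith)]; ring_nf
  have hv' : v ^ b = v ^ (a + b - 1) * v ^ (1 - a) := by
    rw [← Real.rpow_add_of_nonneg hv (by linarith) (by linarith)]; ring_nf
  calc u ^ a * v ^ b * (k₁ ^ (1 - b) * k₂ ^ (1 - a))
      = (u * v) ^ (a + b - 1) * (u * k₁) ^ (1 - b) * (v * k₂) ^ (1 - a) := by
        rw [Real.mul_rpow hu hv, Real.mul_rpow hu hk₁, Real.mul_rpow hv hk₂, hu', hv']; ring
    _ ≤ _ := h
    _ ≤ 1 * (u * v) + 1 * (u * k₁) + 1 * (v * k₂) := by gcongr <;> linarith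
    _ = _ := by ring

/-- A Schur-type test for boundedness of a bilinear form. -/
lemma BoundedForm.of_schur [SFinite μ] {w k₁ k₂ : Ω → Ω → ℝ} {C₁ C₂ : ℝ}
    (ha : a ≤ 1) (hb : b ≤ 1) (hab : 1 ≤ a + b) (hk₁0 : ∀ x y, 0 ≤ k₁ x y)
    (hk₂0 : ∀ x y, 0 ≤ k₂ x y) (hk₁ : Measurable (Function.uncurry k₁))
    (hk₂ : Measurable (Function.uncurry k₂)) (hC₁ : 0 ≤ C₁) (hC₂ : 0 ≤ C₂)
    (hw : ∀ᵐ x ∂μ, ∀ᵐ y ∂μ, w x y ≤ k₁ x y ^ (1 - b) * k₂ x y ^ (1 - a))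
    (h₁ : ∀ᵐ x ∂μ, ∫⁻ y, ENNReal.ofReal (k₁ x y) ∂μ ≤ ENNReal.ofReal C₁)
    (h₂ : ∀ᵐ y ∂μ, ∫⁻ x, ENNReal.ofReal (k₂ x y) ∂μ ≤ ENNReal.ofReal C₂) :
    BoundedForm μ a b w := by
  refine ⟨1 + C₁ + C₂, by positivity, fun u v hu hv hu0 hv0 hu1 hv1 => ?_⟩
  refine lintegral_lintegral_le_of_kernel_bounds hu hv hu0 hv0 hu1 hv1 hk₁ hk₂ hC₁ hC₂ ?_ h₁ h₂
  filter_upwards [hw] with x hx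
  filter_upwards [hx] with y hy
  refine le_trans ?_ (rpow_mul_rpow_mul_le_add (hu0 x) (hv0 y) (hk₁0 x y) (hk₂0 x y) ha hb hab)
  have := hu0 x
  have := hv0 y
  gcongr

lemma BoundedForm.mono {w w' : Ω → Ω → ℝ} {D : ℝ} (hD : 0 ≤ D) (h : BoundedForm μ a b w)
    (hw : ∀ᵐ x ∂μ, ∀ᵐ y ∂μ, w' x y ≤ D * w x y) : BoundedForm μ a b w' := by
  obtain ⟨C, hC, H⟩ := h
  refine ⟨D * C, by positivity, fun u v hu hv hu0 hv0 hu1 hv1 => ?_⟩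
  rw [ENNReal.ofReal_mul hD]
  grw [← H u v hu hv hu0 hv0 hu1 hv1]
  rw [← lintegral_const_mul' _ _ ENNReal.ofReal_ne_top]
  refine lintegral_mono_ae ?_
  filter_upwards [hw] with x hx
  rw [← lintegral_const_mul' _ _ ENNReal.ofReal_ne_top]
  refine lintegral_mono_ae ?_
  filter_upwards [hx] with y hy
  rw [← ENNReal.ofReal_mul hD]
  refine ENNReal.ofReal_le_ofReal ?_
  have := hu0 x
  have := hv0 y
  calc u x ^ a * v y ^ b * w' x y ≤ u x ^ a * v y ^ b * (D * w x y) := by gcongr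
    _ = _ := by ring

lemma BoundedForm.add [SFinite μ] {w w' : Ω → Ω → ℝ} (h : BoundedForm μ a b w)
    (h' : BoundedForm μ a b w') (hw : Measurable (Function.uncurry w)) :
    BoundedForm μ a b (fun x y => w x y + w' x y) := by
  obtain ⟨C, hC, H⟩ := h
  obtain ⟨C', hC', H'⟩ := h'
  refine ⟨C + C', by positivity, fun u v hu hv hu0 hv0 hu1 hv1 => ?_⟩
  have hm : Measurable fun z : Ω × Ω => ENNReal.ofReal (u z.1 ^ a * v z.2 ^ b * w z.1 z.2) :=
    ((((hu.comp measurable_fst).pow_const a).mul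
      ((hv.comp measurable_snd).pow_const b)).mul hw).ennreal_ofReal
  rw [ENNReal.ofReal_add hC hC']
  grw [← H u v hu hv hu0 hv0 hu1 hv1, ← H' u v hu hv hu0 hv0 hu1 hv1]
  rw [← lintegral_add_left hm.lintegral_prod_right']
  refine lintegral_mono fun x => ?_
  rw [← lintegral_add_left (by exact hm.comp measurable_prodMk_left)]
  refine lintegral_mono fun y => ?_
  rw [mul_add]
  exact ENNReal.ofReal_add_le

lemma BoundedForm.swap [SFinite μ] {w : Ω → Ω → ℝ} (h : BoundedForm μ a b w)
    (hw : Measurable (Function.uncurry w)) : BoundedForm μ b a (fun x y => w y x) := by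
  obtain ⟨C, hC, H⟩ := h
  refine ⟨C, hC, fun u v hu hv hu0 hv0 hu1 hv1 => ?_⟩
  have hm : Measurable fun z : Ω × Ω => ENNReal.ofReal (u z.1 ^ b * v z.2 ^ a * w z.2 z.1) :=
    ((((hu.comp measurable_fst).pow_const b).mul
      ((hv.comp measurable_snd).pow_const a)).mul (hw.comp measurable_swap)).ennreal_ofReal
  rw [lintegral_lintegral_swap hm.aemeasurable]
  simp_rw [mul_comm (u _ ^ b)]
  exact H v u hv hu hv0 hu0 hv1 hu1

end BilinearForm

/-- The pointwise splitting behind the Hardy–Littlewood–Sobolev inequality. -/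
lemma rpow_mul_rpow_mul_rpow_neg_le {a b c u v t : ℝ} (ha0 : 0 < a) (hb0 : 0 < b) (ha : a ≤ 1)
    (hb : b ≤ 1) (habc : a + b + c = 2) (hu : 0 ≤ u) (hv : 0 ≤ v) (ht : 0 < t) :
    u ^ a * v ^ b * t ^ (-c) ≤ u * v +
      u * (u ^ (a - 1) * (if 1 < u * t then t ^ (-(2 - a)) else 0) +
        u ^ (a + b - 1) * (if u * t ≤ 1 then t ^ (-c) else 0)) +
      v * (v ^ (b - 1) * (if 1 < v * t then t ^ (-(2 - b)) else 0) +
        v ^ (a + b - 1) * (if v * t ≤ 1 then t ^ (-c) else 0)) := by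
  have n1 : 0 ≤ u * (u ^ (a - 1) * (if 1 < u * t then t ^ (-(2 - a)) else 0) +
        u ^ (a + b - 1) * (if u * t ≤ 1 then t ^ (-c) else 0)) := by
    split_ifs <;> positivity
  have n2 : 0 ≤ v * (v ^ (b - 1) * (if 1 < v * t then t ^ (-(2 - b)) else 0) +
        v ^ (a + b - 1) * (if v * t ≤ 1 then t ^ (-c) else 0)) := by
    split_ifs <;> positivity
  have n0 : 0 ≤ u * v := by positivity
  rcases hu.eq_or_lt with rfl | hu
  · rw [Real.zero_rpow ha0.ne']; linarith
  rcases hv.eq_or_lt with rfl | hv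
  · rw [Real.zero_rpow hb0.ne']; linarith
  have e : ∀ {x s r : ℝ}, 0 < x → r = s + 1 → x ^ r = x * x ^ s := fun hx h => by
    rw [h, Real.rpow_add_one hx.ne', mul_comm]
  by_cases h1 : 1 < u * t <;> by_cases h2 : 1 < v * t
  · have : u ^ a * v ^ b * t ^ (-c) = u * v * ((u * t) ^ (a - 1) * (v * t) ^ (b - 1)) := by
      rw [Real.mul_rpow hu.le ht.le, Real.mul_rpow hv.le ht.le, e hu (sub_add_cancel a 1).symm,
        e hv (sub_add_cancel b 1).symm, show -c = (a - 1) + (b - 1) by linarith,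
        Real.rpow_add ht]
      ring
    have h3 : (u * t) ^ (a - 1) * (v * t) ^ (b - 1) ≤ 1 :=
      mul_le_one₀ (Real.rpow_le_one_of_one_le_of_nonpos h1.le (by linarith)) (by positivity)
        (Real.rpow_le_one_of_one_le_of_nonpos h2.le (by linarith))
    have : u ^ a * v ^ b * t ^ (-c) ≤ u * v := by
      rw [this]; exact mul_le_of_le_one_right n0 h3
    linarith
  · have h3 : v ^ b ≤ t ^ (-b) := by
      rw [Real.rpow_neg ht.le, ← Real.inv_rpow ht.le]
      refine Real.rpow_le_rpow hv.le ?_ hb0.le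
      rw [← one_div, le_div_iff₀ ht]
      exact not_lt.1 h2
    have : u ^ a * v ^ b * t ^ (-c) ≤ u * (u ^ (a - 1) * t ^ (-(2 - a))) := by
      calc u ^ a * v ^ b * t ^ (-c) ≤ u ^ a * t ^ (-b) * t ^ (-c) := by gcongr
        _ = _ := by
          rw [e hu (sub_add_cancel a 1).symm, show -(2 - a) = -b + -c by linarith,
            Real.rpow_add ht]
          ring
    simp only [h1, if_true, not_le.2 h1, if_false] at n1 ⊢
    linarith
  · have h3 : u ^ a ≤ t ^ (-a) := by
      rw [Real.rpow_neg ht.le, ← Real.inv_rpow ht.le]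
      refine Real.rpow_le_rpow hu.le ?_ ha0.le
      rw [← one_div, le_div_iff₀ ht]
      exact not_lt.1 h1
    have : u ^ a * v ^ b * t ^ (-c) ≤ v * (v ^ (b - 1) * t ^ (-(2 - b))) := by
      calc u ^ a * v ^ b * t ^ (-c) ≤ t ^ (-a) * v ^ b * t ^ (-c) := by gcongr
        _ = _ := by
          rw [e hv (sub_add_cancel b 1).symm, show -(2 - b) = -a + -c by linarith,
            Real.rpow_add ht]
          ring
    simp only [h2, if_true, not_le.2 h2, if_false] at n2 ⊢
    linarith
  · simp only [h1, h2, if_false, not_lt.1 h1, not_lt.1 h2, if_true, mul_zero, zero_add] at n1 n2 ⊢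
    rcases le_total v u with hvu | hvu
    · have : u ^ a * v ^ b * t ^ (-c) ≤ u * (u ^ (a + b - 1) * t ^ (-c)) := by
        calc u ^ a * v ^ b * t ^ (-c) ≤ u ^ a * u ^ b * t ^ (-c) := by gcongr
          _ = _ := by rw [← Real.rpow_add hu, e hu (sub_add_cancel (a + b) 1).symm]; ring
      linarith
    · have : u ^ a * v ^ b * t ^ (-c) ≤ v * (v ^ (a + b - 1) * t ^ (-c)) := by
        calc u ^ a * v ^ b * t ^ (-c) ≤ v ^ a * v ^ b * t ^ (-c) := by gcongr
          _ = _ := by rw [← Real.rpow_add hv, e hv (sub_add_cancel (a + b) 1).symm]; ring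
      linarith

section HardyLittlewoodSobolev

variable {E : Type*} [NormedAddCommGroup E] [NormedSpace ℝ E] [Nontrivial E]
  [FiniteDimensional ℝ E] [MeasurableSpace E] [BorelSpace E]

lemma exists_lintegral_hls_kernel_le (μ : Measure E) [μ.IsAddHaarMeasure] {a b c : ℝ} (ha : a < 1)
    (hc : c < 1) (habc : a + b + c = 2) :
    ∃ C : ℝ, 0 ≤ C ∧ ∀ s : ℝ, 0 ≤ s →
      ∫⁻ y, ENNReal.ofReal
        (s ^ (a - 1) * (if 1 < s * ‖y‖ ^ (Module.finrank ℝ E : ℝ) then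
            (‖y‖ ^ (Module.finrank ℝ E : ℝ)) ^ (-(2 - a)) else 0) +
          s ^ (a + b - 1) * (if s * ‖y‖ ^ (Module.finrank ℝ E : ℝ) ≤ 1 then
            (‖y‖ ^ (Module.finrank ℝ E : ℝ)) ^ (-c) else 0)) ∂μ ≤ ENNReal.ofReal C := by
  have hd : (0 : ℝ) < Module.finrank ℝ E := by exact_mod_cast Module.finrank_pos
  obtain ⟨C₁, hC₁, h₁⟩ := exists_lintegral_rpow_norm_le_outside μ
    (κ := Module.finrank ℝ E * (2 - a)) (by nlinarith)
  obtain ⟨C₂, hC₂, h₂⟩ := exists_lintegral_rpow_norm_le_inside μ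
    (κ := Module.finrank ℝ E * c) (by nlinarith)
  set d : ℝ := (Module.finrank ℝ E : ℝ)
  refine ⟨C₁ + C₂, by positivity, fun s hs => ?_⟩
  rcases hs.eq_or_lt with rfl | hs
  · simp [Real.zero_rpow (show a + b - 1 ≠ 0 by linarith), not_lt.2 zero_le_one]
  set R := s ^ (-(1 / d)) with hR
  have hR0 : 0 < R := by positivity
  have hRd : ∀ e : ℝ, R ^ (d * e) = s ^ (-e) := fun e => by
    rw [hR, ← Real.rpow_mul hs.le]; congr 1; field_simp
  have hiff : ∀ y : E, 1 < s * ‖y‖ ^ d ↔ R < ‖y‖ := fun y => by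
    rw [← Real.rpow_lt_rpow_iff hR0.le (norm_nonneg y) hd, ← mul_one d, hRd 1, Real.rpow_neg_one,
      inv_lt_iff_one_lt_mul₀' hs]
  have hpt : ∀ y : E, ENNReal.ofReal
        (s ^ (a - 1) * (if 1 < s * ‖y‖ ^ d then (‖y‖ ^ d) ^ (-(2 - a)) else 0) +
          s ^ (a + b - 1) * (if s * ‖y‖ ^ d ≤ 1 then (‖y‖ ^ d) ^ (-c) else 0)) =
      ENNReal.ofReal (s ^ (a - 1)) *
        ENNReal.ofReal (if R < ‖y‖ then ‖y‖ ^ (-(d * (2 - a))) else 0) +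
      ENNReal.ofReal (s ^ (a + b - 1)) *
        ENNReal.ofReal (if ‖y‖ ≤ R then ‖y‖ ^ (-(d * c)) else 0) := fun y => by
    rw [← ENNReal.ofReal_mul (by positivity), ← ENNReal.ofReal_mul (by positivity),
      ← ENNReal.ofReal_add (by split_ifs <;> positivity) (by split_ifs <;> positivity)]
    simp_rw [← not_lt, hiff, ← Real.rpow_mul (norm_nonneg y), mul_neg]
  have hmeas : Measurable fun y : E =>
      ENNReal.ofReal (if R < ‖y‖ then ‖y‖ ^ (-(d * (2 - a))) else 0) :=
    (Measurable.ite (measurableSet_lt measurable_const measurable_norm) (by fun_prop)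
      measurable_const).ennreal_ofReal
  simp_rw [hpt]
  rw [lintegral_add_left (hmeas.const_mul _), lintegral_const_mul' _ _ ENNReal.ofReal_ne_top,
    lintegral_const_mul' _ _ ENNReal.ofReal_ne_top]
  grw [h₁ R hR0, h₂ R hR0]
  rw [← ENNReal.ofReal_mul (by positivity), ← ENNReal.ofReal_mul (by positivity),
    ← ENNReal.ofReal_add (by positivity) (by positivity)]
  apply le_of_eq
  congr 1
  have e1 : d - d * (2 - a) = d * (a - 1) := by ring
  have e2 : d - d * c = d * (1 - c) := by ring
  rw [e1, e2, hRd, hRd, mul_left_comm, mul_left_comm _ C₂, ← Real.rpow_add hs, ← Real.rpow_add hs,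
    add_neg_cancel, show a + b - 1 + -(1 - c) = 0 by linarith]
  simp

/-- The Hardy–Littlewood–Sobolev inequality. -/
lemma BoundedForm.hls (μ : Measure E) [μ.IsAddHaarMeasure] {a b c : ℝ} (ha0 : 0 < a)
    (hb0 : 0 < b) (ha : a < 1) (hb : b < 1) (hc : c < 1) (habc : a + b + c = 2) :
    BoundedForm μ a b (fun x y => ‖x - y‖ ^ (-(Module.finrank ℝ E * c))) := by
  obtain ⟨C₁, hC₁, h₁⟩ := exists_lintegral_hls_kernel_le μ (b := b) ha hc habc
  obtain ⟨C₂, hC₂, h₂⟩ := exists_lintegral_hls_kernel_le μ (b := a) hb hc (by linarith)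
  set d : ℝ := (Module.finrank ℝ E : ℝ)
  refine ⟨1 + C₁ + C₂, by positivity, fun u v hu hv hu0 hv0 hu1 hv1 => ?_⟩
  have hmeas : ∀ (f : E × E → ℝ) (e₁ e₂ e₃ e₄ : ℝ), Measurable f → Measurable fun z : E × E =>
      f z ^ e₁ * (if 1 < f z * ‖z.1 - z.2‖ ^ d then (‖z.1 - z.2‖ ^ d) ^ e₂ else 0) +
        f z ^ e₃ * (if f z * ‖z.1 - z.2‖ ^ d ≤ 1 then (‖z.1 - z.2‖ ^ d) ^ e₄ else 0) := by
    intro f e₁ e₂ e₃ e₄ hf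
    refine ((hf.pow_const _).mul (Measurable.ite (measurableSet_lt measurable_const ?_) ?_
      measurable_const)).add ((hf.pow_const _).mul
      (Measurable.ite (measurableSet_le ?_ measurable_const) ?_ measurable_const)) <;> fun_prop
  refine lintegral_lintegral_le_of_kernel_bounds hu hv hu0 hv0 hu1 hv1
    (κ₁ := fun x y => u x ^ (a - 1) *
        (if 1 < u x * ‖x - y‖ ^ d then (‖x - y‖ ^ d) ^ (-(2 - a)) else 0) +
      u x ^ (a + b - 1) * (if u x * ‖x - y‖ ^ d ≤ 1 then (‖x - y‖ ^ d) ^ (-c) else 0))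
    (κ₂ := fun x y => v y ^ (b - 1) *
        (if 1 < v y * ‖x - y‖ ^ d then (‖x - y‖ ^ d) ^ (-(2 - b)) else 0) +
      v y ^ (b + a - 1) * (if v y * ‖x - y‖ ^ d ≤ 1 then (‖x - y‖ ^ d) ^ (-c) else 0))
    (hmeas (fun z => u z.1) _ _ _ _ (hu.comp measurable_fst))
    (hmeas (fun z => v z.2) _ _ _ _ (hv.comp measurable_snd)) hC₁ hC₂ ?_ ?_ ?_
  · refine Eventually.of_forall fun x => ?_
    filter_upwards [Measure.ae_ne μ x] with y hy
    have ht : 0 < ‖x - y‖ := norm_sub_pos_iff.2 hy.symm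
    have := rpow_mul_rpow_mul_rpow_neg_le ha0 hb0 ha.le hb.le habc (hu0 x) (hv0 y)
      (Real.rpow_pos_of_pos ht d)
    rw [add_comm b a]
    simpa only [← Real.rpow_mul ht.le, mul_neg] using this
  · refine Eventually.of_forall fun x => ?_
    rw [lintegral_sub_left_eq_self (fun z => ENNReal.ofReal (u x ^ (a - 1) *
        (if 1 < u x * ‖z‖ ^ d then (‖z‖ ^ d) ^ (-(2 - a)) else 0) +
      u x ^ (a + b - 1) * (if u x * ‖z‖ ^ d ≤ 1 then (‖z‖ ^ d) ^ (-c) else 0))) x]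
    exact h₁ _ (hu0 x)
  · refine Eventually.of_forall fun y => ?_
    rw [lintegral_sub_right_eq_self (fun z => ENNReal.ofReal (v y ^ (b - 1) *
        (if 1 < v y * ‖z‖ ^ d then (‖z‖ ^ d) ^ (-(2 - b)) else 0) +
      v y ^ (b + a - 1) * (if v y * ‖z‖ ^ d ≤ 1 then (‖z‖ ^ d) ^ (-c) else 0))) y]
    exact h₂ _ (hv0 y)

end HardyLittlewoodSobolev

section Kernels

variable {m n : ℕ}

lemma lintegral_rsplit_mul_le {h φ : (Fin m → ℝ) → ℝ} {ψ : Rsplit m n → ℝ} (hh : Measurable h)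
    (hψ : Measurable ψ) (hh0 : ∀ y, 0 ≤ h y)
    (hφ : ∀ᵐ y', ∫⁻ z, ENNReal.ofReal (ψ (y', z)) ≤ ENNReal.ofReal (φ y')) :
    ∫⁻ y : Rsplit m n, ENNReal.ofReal (h y.1 * ψ y) ≤ ∫⁻ y', ENNReal.ofReal (h y' * φ y') := by
  rw [Measure.volume_eq_prod, lintegral_prod _ (by fun_prop)]
  refine lintegral_mono_ae ?_
  filter_upwards [hφ] with y' hy'
  simp_rw [ENNReal.ofReal_mul (hh0 y')]
  rw [lintegral_const_mul' _ _ ENNReal.ofReal_ne_top]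
  gcongr

lemma ae_rsplit_fst_ne (hm : 1 ≤ m) (a : Fin m → ℝ) : ∀ᵐ y : Rsplit m n, y.1 ≠ a := by
  have : Nonempty (Fin m) := ⟨⟨0, hm⟩⟩
  rw [Measure.volume_eq_prod]
  exact Measure.quasiMeasurePreserving_fst.ae (Measure.ae_ne volume a)

/-- The part of the Stein–Weiss kernel where `y'` is small compared to `x'`. -/
def farKernel (α β lam : ℝ) (x y : Rsplit m n) : ℝ :=
  if 2 * ‖y.1‖ ≤ ‖x.1‖ then ‖x.1‖ ^ (-α) * ‖y.1‖ ^ (-β) * ‖x - y‖ ^ (-lam) else 0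

/-- The part of the Stein–Weiss kernel where `x'` and `y'` have comparable size. -/
def nearKernel (α β lam : ℝ) (x y : Rsplit m n) : ℝ :=
  if ‖y.1‖ ≤ 2 * ‖x.1‖ ∧ ‖x.1‖ ≤ 2 * ‖y.1‖ then
    ‖x.1‖ ^ (-α) * ‖y.1‖ ^ (-β) * ‖x - y‖ ^ (-lam) else 0

lemma measurable_farKernel (α β lam : ℝ) :
    Measurable (Function.uncurry (farKernel (m := m) (n := n) α β lam)) := by
  unfold farKernel Function.uncurry
  exact Measurable.ite (measurableSet_le (by fun_prop) (by fun_prop)) (by fun_prop)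
    measurable_const

lemma measurable_nearKernel (α β lam : ℝ) :
    Measurable (Function.uncurry (nearKernel (m := m) (n := n) α β lam)) := by
  unfold nearKernel Function.uncurry
  refine Measurable.ite ?_ (by fun_prop) measurable_const
  rw [Set.ofPred_and]
  exact (measurableSet_le (by fun_prop) (by fun_prop)).inter
    (measurableSet_le (by fun_prop) (by fun_prop))

/-- Majorant of the kernel in the region where `y'` is small compared to `x'`. -/
def hardyKernel (M e₁ e₂ : ℝ) (x y : Rsplit m n) : ℝ :=
  (if 2 * ‖y.1‖ ≤ ‖x.1‖ then ‖x.1‖ ^ e₁ * ‖y.1‖ ^ e₂ else 0) *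
    max ‖x.1‖ ‖x.2 - y.2‖ ^ (-M)

lemma hardyKernel_nonneg (M e₁ e₂ : ℝ) (x y : Rsplit m n) : 0 ≤ hardyKernel M e₁ e₂ x y := by
  unfold hardyKernel
  split_ifs <;> positivity

lemma measurable_hardyKernel (M e₁ e₂ : ℝ) :
    Measurable (Function.uncurry (hardyKernel (m := m) (n := n) M e₁ e₂)) := by
  unfold hardyKernel Function.uncurry
  exact (Measurable.ite (measurableSet_le (by fun_prop) (by fun_prop)) (by fun_prop)
    measurable_const).mul (by fun_prop)

lemma exists_lintegral_hardyKernel_right_le (hm : 1 ≤ m) (hn : 1 ≤ n) {M s e : ℝ} (hM : n < M)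
    (hs : 0 < s) (he : e = M - n - m * s) :
    ∃ C : ℝ, 0 ≤ C ∧ ∀ x : Rsplit m n, x.1 ≠ 0 →
      ∫⁻ y, ENNReal.ofReal (hardyKernel M e (-(m * (1 - s))) x y) ≤ ENNReal.ofReal C := by
  have : Nonempty (Fin m) := ⟨⟨0, hm⟩⟩
  have : Nonempty (Fin n) := ⟨⟨0, hn⟩⟩
  have hm0 : (0 : ℝ) < m := by exact_mod_cast hm
  obtain ⟨C₁, hC₁, h₁⟩ := exists_lintegral_rpow_max_norm_le (volume : Measure (Fin n → ℝ))
    (M := M) (by simpa using hM)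
  obtain ⟨C₂, hC₂, h₂⟩ := exists_lintegral_rpow_norm_le_inside (volume : Measure (Fin m → ℝ))
    (κ := m * (1 - s)) (by rw [Module.finrank_fin_fun]; nlinarith)
  simp only [Module.finrank_fin_fun] at h₁ h₂
  refine ⟨C₁ * C₂ * 2⁻¹ ^ (m * s), by positivity, fun x hx => ?_⟩
  have hx0 : 0 < ‖x.1‖ := norm_pos_iff.2 hx
  refine (lintegral_rsplit_mul_le (φ := fun _ => C₁ * ‖x.1‖ ^ ((n : ℝ) - M))
    (h := fun y' => if 2 * ‖y'‖ ≤ ‖x.1‖ then ‖x.1‖ ^ e * ‖y'‖ ^ (-(m * (1 - s))) else 0)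
    (ψ := fun y => max ‖x.1‖ ‖x.2 - y.2‖ ^ (-M))
    (Measurable.ite (measurableSet_le (by fun_prop) (by fun_prop)) (by fun_prop)
      measurable_const) (by fun_prop) (fun y => by split_ifs <;> positivity)
    (Eventually.of_forall fun y' => h₁ x.2 _ hx0)).trans ?_
  have hpt : ∀ y' : Fin m → ℝ, ENNReal.ofReal ((if 2 * ‖y'‖ ≤ ‖x.1‖ then
        ‖x.1‖ ^ e * ‖y'‖ ^ (-(m * (1 - s))) else 0) * (C₁ * ‖x.1‖ ^ ((n : ℝ) - M))) =
      ENNReal.ofReal (‖x.1‖ ^ e * (C₁ * ‖x.1‖ ^ ((n : ℝ) - M))) *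
        ENNReal.ofReal (if ‖y'‖ ≤ 2⁻¹ * ‖x.1‖ then ‖y'‖ ^ (-(m * (1 - s))) else 0) := fun y' => by
    rw [← ENNReal.ofReal_mul (by positivity)]
    have : 2 * ‖y'‖ ≤ ‖x.1‖ ↔ ‖y'‖ ≤ 2⁻¹ * ‖x.1‖ := by
      constructor <;> intro h <;> linarith
    simp_rw [this]
    split_ifs
    · ring_nf
    · simp
  simp_rw [hpt]
  rw [lintegral_const_mul' _ _ ENNReal.ofReal_ne_top]
  grw [h₂ _ (by positivity)]
  rw [← ENNReal.ofReal_mul (by positivity)]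
  apply le_of_eq
  congr 1
  rw [show (m : ℝ) - m * (1 - s) = m * s by ring, Real.mul_rpow (by norm_num) hx0.le]
  have : ‖x.1‖ ^ e * ‖x.1‖ ^ ((n : ℝ) - M) * ‖x.1‖ ^ (m * s) = 1 := by
    rw [← Real.rpow_add hx0, ← Real.rpow_add hx0, he,
      show M - n - m * s + (n - M) + m * s = 0 by ring, Real.rpow_zero]
  linear_combination C₁ * C₂ * 2⁻¹ ^ (m * s) * this

lemma exists_lintegral_hardyKernel_left_le (hm : 1 ≤ m) (hn : 1 ≤ n) {M s e : ℝ} (hM : n < M)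
    (hs : 0 < s) (he : e = M - n - m * (s + 1)) :
    ∃ C : ℝ, 0 ≤ C ∧ ∀ y : Rsplit m n, y.1 ≠ 0 →
      ∫⁻ x, ENNReal.ofReal (hardyKernel M e (m * s) x y) ≤ ENNReal.ofReal C := by
  have : Nonempty (Fin m) := ⟨⟨0, hm⟩⟩
  have : Nonempty (Fin n) := ⟨⟨0, hn⟩⟩
  have hm0 : (0 : ℝ) < m := by exact_mod_cast hm
  obtain ⟨C₁, hC₁, h₁⟩ := exists_lintegral_rpow_max_norm_le (volume : Measure (Fin n → ℝ))
    (M := M) (by simpa using hM)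
  obtain ⟨C₂, hC₂, h₂⟩ := exists_lintegral_rpow_norm_le_outside (volume : Measure (Fin m → ℝ))
    (κ := m * (s + 1)) (by rw [Module.finrank_fin_fun]; nlinarith)
  simp only [Module.finrank_fin_fun] at h₁ h₂
  refine ⟨C₁ * C₂, by positivity, fun y hy => ?_⟩
  have hy0 : 0 < ‖y.1‖ := norm_pos_iff.2 hy
  refine (lintegral_rsplit_mul_le (φ := fun x' => C₁ * ‖x'‖ ^ ((n : ℝ) - M))
    (h := fun x' => if 2 * ‖y.1‖ ≤ ‖x'‖ then ‖x'‖ ^ e * ‖y.1‖ ^ (m * s) else 0)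
    (ψ := fun x => max ‖x.1‖ ‖x.2 - y.2‖ ^ (-M))
    (Measurable.ite (measurableSet_le (by fun_prop) (by fun_prop)) (by fun_prop)
      measurable_const) (by fun_prop) (fun y => by split_ifs <;> positivity) ?_).trans ?_
  · filter_upwards [Measure.ae_ne volume (0 : Fin m → ℝ)] with x' hx'
    simp_rw [norm_sub_rev _ y.2]
    exact h₁ y.2 _ (norm_pos_iff.2 hx')
  have hpt : ∀ x' : Fin m → ℝ, ENNReal.ofReal ((if 2 * ‖y.1‖ ≤ ‖x'‖ then
        ‖x'‖ ^ e * ‖y.1‖ ^ (m * s) else 0) * (C₁ * ‖x'‖ ^ ((n : ℝ) - M))) ≤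
      ENNReal.ofReal (C₁ * ‖y.1‖ ^ (m * s)) *
        ENNReal.ofReal (if ‖y.1‖ < ‖x'‖ then ‖x'‖ ^ (-(m * (s + 1))) else 0) := fun x' => by
    rw [← ENNReal.ofReal_mul (by positivity)]
    refine ENNReal.ofReal_le_ofReal ?_
    by_cases h : 2 * ‖y.1‖ ≤ ‖x'‖
    · have h' : ‖y.1‖ < ‖x'‖ := by linarith
      have hx0 := hy0.trans h'
      have : ‖x'‖ ^ e * ‖x'‖ ^ ((n : ℝ) - M) = ‖x'‖ ^ (-(m * (s + 1))) := by
        rw [← Real.rpow_add hx0, he]; ring_nf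
      rw [if_pos h, if_pos h', ← this]
      apply le_of_eq
      ring
    · rw [if_neg h, zero_mul]
      split_ifs <;> positivity
  refine (lintegral_mono hpt).trans ?_
  rw [lintegral_const_mul' _ _ ENNReal.ofReal_ne_top]
  grw [h₂ _ hy0]
  rw [← ENNReal.ofReal_mul (by positivity)]
  apply le_of_eq
  congr 1
  have : ‖y.1‖ ^ (m * s) * ‖y.1‖ ^ ((m : ℝ) - m * (s + 1)) = 1 := by
    rw [← Real.rpow_add hy0, show m * s + ((m : ℝ) - m * (s + 1)) = 0 by ring, Real.rpow_zero]
  linear_combination C₁ * C₂ * this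

lemma BoundedForm.farKernel (hm : 1 ≤ m) (hn : 1 ≤ n) {a b c α β lam : ℝ} (ha : a ≤ 1)
    (hb : b ≤ 1) (hab : 1 ≤ a + b) (hc : 0 < c) (habc : a + b + c = 2) (hlam : 0 < lam)
    (hlamc : n * c < lam) (hβ : β < m * (1 - b)) (hbal : (n + m) * c = lam + α + β) :
    BoundedForm (volume : Measure (Rsplit m n)) a b (farKernel α β lam) := by
  have hm0 : (0 : ℝ) < m := by exact_mod_cast hm
  set M := lam / c with hMdef
  have hM : n < M := by rwa [hMdef, lt_div_iff₀ hc]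
  have hMc : M * c = lam := div_mul_cancel₀ _ hc.ne'
  set s := (α + lam - n * c - m * (1 - a)) / (m * c) with hsdef
  have hs : 0 < s := by
    apply div_pos _ (by positivity)
    nlinarith
  have hsc : m * c * s = α + lam - n * c - m * (1 - a) := mul_div_cancel₀ _ (by positivity)
  obtain ⟨C₁, hC₁, h₁⟩ := exists_lintegral_hardyKernel_right_le hm hn hM hs rfl
  obtain ⟨C₂, hC₂, h₂⟩ := exists_lintegral_hardyKernel_left_le hm hn hM hs rfl
  have key := BoundedForm.of_schur (μ := (volume : Measure (Rsplit m n))) ha hb hab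
    (hardyKernel_nonneg _ _ _) (hardyKernel_nonneg _ _ _) (measurable_hardyKernel _ _ _)
    (measurable_hardyKernel _ _ _) hC₁ hC₂
    (Eventually.of_forall fun x => Eventually.of_forall fun y => le_rfl)
    ((ae_rsplit_fst_ne hm 0).mono h₁) ((ae_rsplit_fst_ne hm 0).mono h₂)
  refine key.mono (D := 2 ^ lam) (by positivity) ?_
  filter_upwards [ae_rsplit_fst_ne hm 0] with x hx
  filter_upwards [ae_rsplit_fst_ne hm 0] with y hy
  have hx0 : 0 < ‖x.1‖ := norm_pos_iff.2 hx
  have hy0 : 0 < ‖y.1‖ := norm_pos_iff.2 hy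
  unfold _root_.farKernel hardyKernel
  by_cases h : 2 * ‖y.1‖ ≤ ‖x.1‖
  · simp only [h, if_true]
    set W := max ‖x.1‖ ‖x.2 - y.2‖ with hW
    have hW0 : 0 < W := lt_max_of_lt_left hx0
    have hWle : 2⁻¹ * W ≤ ‖x - y‖ := by
      have hle₁ : ‖x.1 - y.1‖ ≤ ‖x - y‖ := norm_fst_le (x - y)
      have hle₂ : ‖x.2 - y.2‖ ≤ ‖x - y‖ := norm_snd_le (x - y)
      have := norm_sub_norm_le x.1 y.1
      have := norm_nonneg (x - y)
      have : W ≤ 2 * ‖x - y‖ := max_le (by linarith) (by linarith)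
      linarith
    have hlamW : ‖x - y‖ ^ (-lam) ≤ 2 ^ lam * W ^ (-lam) := by
      calc ‖x - y‖ ^ (-lam) ≤ (2⁻¹ * W) ^ (-lam) :=
            Real.rpow_le_rpow_of_nonpos (by positivity) hWle (by linarith)
        _ = _ := by
          rw [Real.mul_rpow (by norm_num) hW0.le, Real.inv_rpow (by norm_num), Real.rpow_neg
            (by norm_num) lam, inv_inv]
    have hid : (‖x.1‖ ^ (M - n - m * s) * ‖y.1‖ ^ (-(m * (1 - s))) * W ^ (-M)) ^ (1 - b) *
        (‖x.1‖ ^ (M - n - m * (s + 1)) * ‖y.1‖ ^ (m * s) * W ^ (-M)) ^ (1 - a) =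
        ‖x.1‖ ^ (-α) * ‖y.1‖ ^ (-β) * W ^ (-lam) := by
      rw [Real.mul_rpow (by positivity) (by positivity), Real.mul_rpow (by positivity)
        (by positivity), Real.mul_rpow (by positivity) (by positivity), Real.mul_rpow
        (by positivity) (by positivity)]
      simp only [← Real.rpow_mul hx0.le, ← Real.rpow_mul hy0.le, ← Real.rpow_mul hW0.le]
      have e₁ : -α = (M - n - m * s) * (1 - b) + (M - n - m * (s + 1)) * (1 - a) := by
        have : c = 2 - a - b := by linarith
        rw [this] at hMc hsc
        linear_combination hsc - hMc
      have e₂ : -β = -(m * (1 - s)) * (1 - b) + m * s * (1 - a) := by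
        have : c = 2 - a - b := by linarith
        rw [this] at hsc hbal
        linear_combination -hsc + hbal
      have e₃ : -lam = -M * (1 - b) + -M * (1 - a) := by
        have : c = 2 - a - b := by linarith
        rw [this] at hMc
        linear_combination hMc
      rw [e₁, e₂, e₃, Real.rpow_add hx0, Real.rpow_add hy0, Real.rpow_add hW0]
      ring
    rw [hid]
    calc ‖x.1‖ ^ (-α) * ‖y.1‖ ^ (-β) * ‖x - y‖ ^ (-lam)
        ≤ ‖x.1‖ ^ (-α) * ‖y.1‖ ^ (-β) * (2 ^ lam * W ^ (-lam)) := by gcongr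
      _ = _ := by ring
  · simp only [h, if_false]
    positivity

/-- Majorant of the kernel in the region where `x'` and `y'` have comparable size. -/
def comparableKernel (γ M : ℝ) (x y : Rsplit m n) : ℝ :=
  (if ‖y.1‖ ≤ 2 * ‖x.1‖ ∧ ‖x.1‖ ≤ 2 * ‖y.1‖ then ‖x.1‖ ^ (-γ) else 0) * ‖x - y‖ ^ (-M)

lemma comparableKernel_nonneg (γ M : ℝ) (x y : Rsplit m n) : 0 ≤ comparableKernel γ M x y := by
  unfold comparableKernel
  split_ifs <;> positivity

lemma measurable_comparableKernel (γ M : ℝ) :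
    Measurable (Function.uncurry (comparableKernel (m := m) (n := n) γ M)) := by
  unfold comparableKernel Function.uncurry
  refine (Measurable.ite ?_ (by fun_prop) measurable_const).mul (by fun_prop)
  rw [Set.ofPred_and]
  exact (measurableSet_le (by fun_prop) (by fun_prop)).inter
    (measurableSet_le (by fun_prop) (by fun_prop))

lemma measurable_comparableKernel_swap (γ M : ℝ) :
    Measurable (Function.uncurry fun x y : Rsplit m n => comparableKernel γ M y x) := by
  have := (measurable_comparableKernel (m := m) (n := n) γ M).comp measurable_swap
  unfold Function.uncurry Function.comp Prod.swap at this
  exact this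

lemma exists_lintegral_comparableKernel_le (hm : 1 ≤ m) (hn : 1 ≤ n) {γ M : ℝ} (hM : n < M)
    (hMN : M < n + m) (hγ : γ = n + m - M) :
    ∃ C : ℝ, 0 ≤ C ∧ ∀ x : Rsplit m n, x.1 ≠ 0 →
      ∫⁻ y, ENNReal.ofReal (comparableKernel γ M x y) ≤ ENNReal.ofReal C := by
  have : Nonempty (Fin m) := ⟨⟨0, hm⟩⟩
  have : Nonempty (Fin n) := ⟨⟨0, hn⟩⟩
  obtain ⟨C₁, hC₁, h₁⟩ := exists_lintegral_rpow_max_norm_le (volume : Measure (Fin n → ℝ))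
    (M := M) (by simpa using hM)
  obtain ⟨C₂, hC₂, h₂⟩ := exists_lintegral_rpow_norm_le_inside (volume : Measure (Fin m → ℝ))
    (κ := M - n) (by rw [Module.finrank_fin_fun]; linarith)
  simp only [Module.finrank_fin_fun] at h₁ h₂
  refine ⟨C₁ * C₂ * 3 ^ γ, by positivity, fun x hx => ?_⟩
  have hx0 : 0 < ‖x.1‖ := norm_pos_iff.2 hx
  refine (lintegral_rsplit_mul_le (φ := fun y' => C₁ * ‖x.1 - y'‖ ^ ((n : ℝ) - M))
    (h := fun y' => if ‖y'‖ ≤ 2 * ‖x.1‖ ∧ ‖x.1‖ ≤ 2 * ‖y'‖ then ‖x.1‖ ^ (-γ) else 0)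
    (ψ := fun y => ‖x - y‖ ^ (-M)) ?_ (by fun_prop) (fun y => by split_ifs <;> positivity)
    ?_).trans ?_
  · refine Measurable.ite ?_ (by fun_prop) measurable_const
    rw [Set.ofPred_and]
    exact (measurableSet_le (by fun_prop) (by fun_prop)).inter
      (measurableSet_le (by fun_prop) (by fun_prop))
  · filter_upwards [Measure.ae_ne volume x.1] with y' hy'
    exact h₁ x.2 _ (norm_sub_pos_iff.2 hy'.symm)
  have hpt : ∀ y' : Fin m → ℝ, ENNReal.ofReal
        ((if ‖y'‖ ≤ 2 * ‖x.1‖ ∧ ‖x.1‖ ≤ 2 * ‖y'‖ then ‖x.1‖ ^ (-γ) else 0) *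
          (C₁ * ‖x.1 - y'‖ ^ ((n : ℝ) - M))) ≤
      ENNReal.ofReal (C₁ * ‖x.1‖ ^ (-γ)) * ENNReal.ofReal
        (if ‖x.1 - y'‖ ≤ 3 * ‖x.1‖ then ‖x.1 - y'‖ ^ (-(M - n)) else 0) := fun y' => by
    rw [← ENNReal.ofReal_mul (by positivity)]
    refine ENNReal.ofReal_le_ofReal ?_
    by_cases h : ‖y'‖ ≤ 2 * ‖x.1‖ ∧ ‖x.1‖ ≤ 2 * ‖y'‖
    · have h' : ‖x.1 - y'‖ ≤ 3 * ‖x.1‖ := by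
        have := norm_sub_le x.1 y'
        linarith [h.1]
      rw [if_pos h, if_pos h', neg_sub]
      apply le_of_eq
      ring
    · rw [if_neg h, zero_mul]
      split_ifs <;> positivity
  refine (lintegral_mono hpt).trans ?_
  rw [lintegral_const_mul' _ _ ENNReal.ofReal_ne_top, lintegral_sub_left_eq_self
    (fun z => ENNReal.ofReal (if ‖z‖ ≤ 3 * ‖x.1‖ then ‖z‖ ^ (-(M - n)) else 0)) x.1]
  grw [h₂ _ (by positivity)]
  rw [← ENNReal.ofReal_mul (by positivity)]
  apply le_of_eq
  congr 1
  rw [show (m : ℝ) - (M - n) = γ by rw [hγ]; ring, Real.mul_rpow (by norm_num) hx0.le]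
  have : ‖x.1‖ ^ (-γ) * ‖x.1‖ ^ γ = 1 := by
    rw [← Real.rpow_add hx0, neg_add_cancel, Real.rpow_zero]
  linear_combination C₁ * C₂ * 3 ^ γ * this

lemma rpow_le_two_rpow_abs_mul_rpow {x y : ℝ} (hx : 0 < x) (hy : 0 < y) (hxy : x ≤ 2 * y)
    (hyx : y ≤ 2 * x) (e : ℝ) : x ^ e ≤ 2 ^ |e| * y ^ e := by
  rcases le_total 0 e with he | he
  · rw [abs_of_nonneg he, ← Real.mul_rpow (by norm_num) hy.le]
    exact Real.rpow_le_rpow hx.le hxy he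
  · rw [abs_of_nonpos he, Real.rpow_neg (by norm_num), ← Real.inv_rpow (by norm_num),
      ← Real.mul_rpow (by norm_num) hy.le]
    exact Real.rpow_le_rpow_of_nonpos (by positivity) (by linarith) he

lemma nearKernel_le_comparableKernel {a b c α β lam γ M : ℝ} {x y : Rsplit m n}
    (habc : a + b + c = 2) (hMc : M * c = lam) (hγc : γ * c = α + β) (hx : x.1 ≠ 0)
    (hy : y.1 ≠ 0) (hxy : x ≠ y) :
    nearKernel α β lam x y ≤ 2 ^ |γ * (1 - b) - α| *
      (comparableKernel γ M x y ^ (1 - b) * comparableKernel γ M y x ^ (1 - a)) := by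
  have hx0 : 0 < ‖x.1‖ := norm_pos_iff.2 hx
  have hy0 : 0 < ‖y.1‖ := norm_pos_iff.2 hy
  have hd0 : 0 < ‖x - y‖ := norm_sub_pos_iff.2 hxy
  unfold nearKernel comparableKernel
  rw [norm_sub_rev y x]
  by_cases h : ‖y.1‖ ≤ 2 * ‖x.1‖ ∧ ‖x.1‖ ≤ 2 * ‖y.1‖
  · rw [if_pos h, if_pos h, if_pos h.symm]
    have hid : (‖x.1‖ ^ (-γ) * ‖x - y‖ ^ (-M)) ^ (1 - b) *
        (‖y.1‖ ^ (-γ) * ‖x - y‖ ^ (-M)) ^ (1 - a) =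
        ‖x.1‖ ^ (-γ * (1 - b)) * ‖y.1‖ ^ (-γ * (1 - a)) * ‖x - y‖ ^ (-lam) := by
      rw [Real.mul_rpow (by positivity) (by positivity), Real.mul_rpow (by positivity)
        (by positivity)]
      simp only [← Real.rpow_mul hx0.le, ← Real.rpow_mul hy0.le, ← Real.rpow_mul hd0.le]
      have e₃ : -lam = -M * (1 - b) + -M * (1 - a) := by
        rw [← hMc, show c = 2 - a - b by linarith]
        ring
      rw [e₃, Real.rpow_add hd0]
      ring
    have hx' : ‖x.1‖ ^ (-α) = ‖x.1‖ ^ (-γ * (1 - b)) * ‖x.1‖ ^ (γ * (1 - b) - α) := by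
      rw [← Real.rpow_add hx0]; ring_nf
    have hy' : ‖y.1‖ ^ (-γ * (1 - a)) = ‖y.1‖ ^ (γ * (1 - b) - α) * ‖y.1‖ ^ (-β) := by
      rw [← Real.rpow_add hy0]
      congr 1
      rw [show c = 2 - a - b by linarith] at hγc
      linarith
    rw [hid, hx', hy']
    calc _ ≤ ‖x.1‖ ^ (-γ * (1 - b)) *
          (2 ^ |γ * (1 - b) - α| * ‖y.1‖ ^ (γ * (1 - b) - α)) * ‖y.1‖ ^ (-β) *
          ‖x - y‖ ^ (-lam) := by
          gcongr
          exact rpow_le_two_rpow_abs_mul_rpow hx0 hy0 h.2 h.1 _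
      _ = _ := by ring
  · rw [if_neg h]
    split_ifs <;> positivity

lemma BoundedForm.nearKernel_of_pos (hm : 1 ≤ m) (hn : 1 ≤ n) {a b c α β lam : ℝ} (ha : a ≤ 1)
    (hb : b ≤ 1) (hab : 1 ≤ a + b) (hc : 0 < c) (habc : a + b + c = 2) (hlamc : n * c < lam)
    (hαβ : 0 < α + β) (hbal : (n + m) * c = lam + α + β) :
    BoundedForm (volume : Measure (Rsplit m n)) a b (nearKernel α β lam) := by
  obtain ⟨M, hMdef⟩ : ∃ M, M = lam / c := ⟨_, rfl⟩
  have hM : n < M := by rwa [hMdef, lt_div_iff₀ hc]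
  have hMN : M < n + m := by rw [hMdef, div_lt_iff₀ hc]; linarith
  have hMc : M * c = lam := by rw [hMdef, div_mul_cancel₀ _ hc.ne']
  obtain ⟨γ, hγ⟩ : ∃ γ, γ = n + m - M := ⟨_, rfl⟩
  obtain ⟨C, hC, h⟩ := exists_lintegral_comparableKernel_le hm hn hM hMN hγ
  have hγc : γ * c = α + β := by rw [hγ, sub_mul, hMc]; linarith
  have hae : ∀ᵐ x : Rsplit m n, ∫⁻ y, ENNReal.ofReal (comparableKernel γ M x y) ≤
      ENNReal.ofReal C := (ae_rsplit_fst_ne hm 0).mono h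
  have key := BoundedForm.of_schur (μ := (volume : Measure (Rsplit m n)))
    (w := fun x y => comparableKernel γ M x y ^ (1 - b) * comparableKernel γ M y x ^ (1 - a))
    (k₁ := comparableKernel γ M) (k₂ := fun x y => comparableKernel γ M y x) ha hb hab
    (comparableKernel_nonneg _ _) (fun x y => comparableKernel_nonneg _ _ _ _)
    (measurable_comparableKernel _ _) (measurable_comparableKernel_swap _ _)
    hC hC (Eventually.of_forall fun x => Eventually.of_forall fun y => le_rfl) hae hae
  refine BoundedForm.mono (w' := nearKernel α β lam) (D := 2 ^ |γ * (1 - b) - α|)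
    (by positivity) key ?_
  filter_upwards [ae_rsplit_fst_ne hm 0] with x hx
  filter_upwards [ae_rsplit_fst_ne hm 0, ae_rsplit_fst_ne hm x.1] with y hy hyx
  exact nearKernel_le_comparableKernel habc hMc hγc hx hy fun h => hyx (by rw [h])

lemma BoundedForm.nearKernel_of_add_eq_zero (hm : 1 ≤ m) {a b c α β lam : ℝ} (ha0 : 0 < a)
    (hb0 : 0 < b) (ha : a < 1) (hb : b < 1) (hc : c < 1) (habc : a + b + c = 2)
    (hαβ : α + β = 0) (hbal : (n + m) * c = lam + α + β) :
    BoundedForm (volume : Measure (Rsplit m n)) a b (nearKernel α β lam) := by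
  have : Nonempty (Fin m) := ⟨⟨0, hm⟩⟩
  have : (volume : Measure (Rsplit m n)).IsAddHaarMeasure :=
    Measure.prod.instIsAddHaarMeasure _ _
  have key := BoundedForm.hls (volume : Measure (Rsplit m n)) ha0 hb0 ha hb hc habc
  have hfin : (Module.finrank ℝ (Rsplit m n) : ℝ) * c = lam := by
    rw [Module.finrank_prod, Module.finrank_fin_fun, Module.finrank_fin_fun]
    push_cast
    linarith
  rw [hfin] at key
  refine key.mono (D := 2 ^ |(-α)|) (by positivity) ?_
  filter_upwards [ae_rsplit_fst_ne hm 0] with x hx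
  filter_upwards [ae_rsplit_fst_ne hm 0] with y hy
  have hx0 : 0 < ‖x.1‖ := norm_pos_iff.2 hx
  have hy0 : 0 < ‖y.1‖ := norm_pos_iff.2 hy
  unfold nearKernel
  split_ifs with h
  · gcongr
    calc ‖x.1‖ ^ (-α) * ‖y.1‖ ^ (-β) ≤ 2 ^ |(-α)| * ‖y.1‖ ^ (-α) * ‖y.1‖ ^ (-β) := by
          gcongr
          exact rpow_le_two_rpow_abs_mul_rpow hx0 hy0 h.2 h.1 _
      _ = 2 ^ |(-α)| := by
          rw [mul_assoc, ← Real.rpow_add hy0, show -α + -β = 0 by linarith, Real.rpow_zero,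
            mul_one]
  · positivity

/-- The Stein–Weiss inequality with partial weights for the supremum norms. -/
lemma BoundedForm.steinWeissKernel (hm : 1 ≤ m) (hn : 1 ≤ n) {a b c α β lam : ℝ} (ha0 : 0 < a)
    (hb0 : 0 < b) (ha : a < 1) (hb : b < 1) (hc1 : c ≤ 1) (habc : a + b + c = 2)
    (hlam : 0 < lam) (hlamn : lam < n) (hαβ : 0 ≤ α + β) (hα : α < m * (1 - a))
    (hβ : β < m * (1 - b)) (hbal : (n + m) * c = lam + α + β) :
    BoundedForm (volume : Measure (Rsplit m n)) a b
      (fun x y => ‖x.1‖ ^ (-α) * ‖y.1‖ ^ (-β) * ‖x - y‖ ^ (-lam)) := by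
  have hc : 0 < c := by linarith
  have hlamc : n * c < lam := by
    rw [show c = 2 - a - b by linarith] at hbal ⊢
    linarith
  have hfar := BoundedForm.farKernel hm hn (α := α) ha.le hb.le (by linarith) hc habc hlam hlamc
    hβ hbal
  have hfar' := (BoundedForm.farKernel hm hn (α := β) hb.le ha.le (by linarith) hc (by linarith)
    hlam hlamc hα (by linarith)).swap (measurable_farKernel _ _ _)
  have hnear : BoundedForm (volume : Measure (Rsplit m n)) a b (nearKernel α β lam) := by
    rcases hαβ.eq_or_lt with h | h
    · refine BoundedForm.nearKernel_of_add_eq_zero hm ha0 hb0 ha hb ?_ habc h.symm hbal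
      have hm0 : (0 : ℝ) < m := by exact_mod_cast hm
      nlinarith
    · exact BoundedForm.nearKernel_of_pos hm hn ha.le hb.le (by linarith) hc habc hlamc h hbal
  refine ((hnear.add hfar (measurable_nearKernel _ _ _)).add hfar'
    ((measurable_nearKernel _ _ _).add (measurable_farKernel _ _ _))).mono zero_le_one ?_
  refine Eventually.of_forall fun x => Eventually.of_forall fun y => ?_
  rw [one_mul]
  have hn0 : ∀ α β (x y : Rsplit m n), 0 ≤ _root_.farKernel α β lam x y := fun α β x y => by
    unfold _root_.farKernel
    split_ifs <;> positivity
  have hn1 : 0 ≤ nearKernel α β lam x y := by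
    unfold nearKernel
    split_ifs <;> positivity
  by_cases h₁ : 2 * ‖y.1‖ ≤ ‖x.1‖
  · have : _root_.farKernel α β lam x y = ‖x.1‖ ^ (-α) * ‖y.1‖ ^ (-β) * ‖x - y‖ ^ (-lam) :=
      if_pos h₁
    linarith [hn0 β α y x]
  by_cases h₂ : 2 * ‖x.1‖ ≤ ‖y.1‖
  · have : _root_.farKernel β α lam y x = ‖x.1‖ ^ (-α) * ‖y.1‖ ^ (-β) * ‖x - y‖ ^ (-lam) := by
      rw [_root_.farKernel, if_pos h₂, norm_sub_rev, mul_comm (‖y.1‖ ^ (-β))]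
    linarith [hn0 α β x y]
  · have : nearKernel α β lam x y = ‖x.1‖ ^ (-α) * ‖y.1‖ ^ (-β) * ‖x - y‖ ^ (-lam) :=
      if_pos ⟨(not_le.1 h₂).le, (not_le.1 h₁).le⟩
    linarith [hn0 α β x y, hn0 β α y x]

end Kernels

section Norms

lemma exists_density_of_memLp {Ω : Type*} [MeasurableSpace Ω] {μ : Measure Ω} {r : ℝ} (hr : 0 < r)
    {f : Ω → ℝ} (hf : MemLp f (ENNReal.ofReal r) μ) :
    ∃ u : Ω → ℝ, Measurable u ∧ (∀ x, 0 ≤ u x) ∧ ∫⁻ x, ENNReal.ofReal (u x) ∂μ ≤ 1 ∧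
      ∀ᵐ x ∂μ, |f x| = (eLpNorm f (ENNReal.ofReal r) μ).toReal * u x ^ (1 / r) := by
  have hr0 : ENNReal.ofReal r ≠ 0 := by simpa using hr
  by_cases h0 : eLpNorm f (ENNReal.ofReal r) μ = 0
  · refine ⟨0, measurable_const, fun _ => le_rfl, by simp, ?_⟩
    filter_upwards [(eLpNorm_eq_zero_iff hf.1 hr0).1 h0] with x hx
    simp [hx, h0]
  obtain ⟨A, hA⟩ : ∃ A, A = (eLpNorm f (ENNReal.ofReal r) μ).toReal := ⟨_, rfl⟩
  have hA0 : 0 < A := hA ▸ ENNReal.toReal_pos h0 hf.2.ne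
  have hfm : Measurable (hf.1.mk f) := hf.1.stronglyMeasurable_mk.measurable
  refine ⟨fun x => (|hf.1.mk f x| / A) ^ r, by fun_prop, fun x => by positivity, ?_, ?_⟩
  · have hpt : ∀ x, ENNReal.ofReal ((|hf.1.mk f x| / A) ^ r) =
        ENNReal.ofReal (A ^ (-r)) * ‖hf.1.mk f x‖ₑ ^ r := fun x => by
      rw [Real.enorm_eq_ofReal_abs, ENNReal.ofReal_rpow_of_nonneg (abs_nonneg _) hr.le,
        ← ENNReal.ofReal_mul (by positivity), Real.div_rpow (abs_nonneg _) hA0.le,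
        Real.rpow_neg hA0.le, div_eq_inv_mul]
    simp_rw [hpt]
    rw [lintegral_const_mul' _ _ ENNReal.ofReal_ne_top]
    have hnorm : eLpNorm (hf.1.mk f) (ENNReal.ofReal r) μ = ENNReal.ofReal A := by
      rw [← eLpNorm_congr_ae hf.1.ae_eq_mk, hA, ENNReal.ofReal_toReal hf.2.ne]
    rw [eLpNorm_eq_lintegral_rpow_enorm_toReal hr0 ENNReal.ofReal_ne_top,
      ENNReal.toReal_ofReal hr.le] at hnorm
    have hfi : ∫⁻ x, ‖hf.1.mk f x‖ₑ ^ r ∂μ = ENNReal.ofReal (A ^ r) := by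
      rw [← ENNReal.ofReal_rpow_of_nonneg hA0.le hr.le, ← hnorm, ← ENNReal.rpow_mul,
        one_div_mul_cancel hr.ne', ENNReal.rpow_one]
    rw [hfi, ← ENNReal.ofReal_mul (by positivity), ← Real.rpow_add hA0]
    simp
  · filter_upwards [hf.1.ae_eq_mk] with x hx
    rw [← hA, ← hx, ← Real.rpow_mul (by positivity), mul_one_div_cancel hr.ne', Real.rpow_one,
      mul_div_cancel₀ _ hA0.ne']

lemma BoundedForm.exists_lintegral_le {Ω : Type*} [MeasurableSpace Ω] {μ : Measure Ω}
    {w : Ω → Ω → ℝ} {r s : ℝ} (hr : 0 < r) (hs : 0 < s)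
    (h : BoundedForm μ (1 / r) (1 / s) w) :
    ∃ C : ℝ, 0 < C ∧ ∀ f g : Ω → ℝ, MemLp f (ENNReal.ofReal r) μ → MemLp g (ENNReal.ofReal s) μ →
      ∫⁻ x, ∫⁻ y, ENNReal.ofReal (|f x| * |g y| * w x y) ∂μ ∂μ ≤
        ENNReal.ofReal C * eLpNorm f (ENNReal.ofReal r) μ * eLpNorm g (ENNReal.ofReal s) μ := by
  obtain ⟨C, hC, H⟩ := h
  refine ⟨C + 1, by positivity, fun f g hf hg => ?_⟩
  obtain ⟨u, hu, hu0, hu1, hfu⟩ := exists_density_of_memLp hr hf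
  obtain ⟨v, hv, hv0, hv1, hgv⟩ := exists_density_of_memLp hs hg
  have hAf := ENNReal.ofReal_toReal hf.2.ne
  have hBg := ENNReal.ofReal_toReal hg.2.ne
  have hA0 : 0 ≤ (eLpNorm f (ENNReal.ofReal r) μ).toReal := ENNReal.toReal_nonneg
  have hB0 : 0 ≤ (eLpNorm g (ENNReal.ofReal s) μ).toReal := ENNReal.toReal_nonneg
  generalize (eLpNorm f (ENNReal.ofReal r) μ).toReal = A at *
  generalize (eLpNorm g (ENNReal.ofReal s) μ).toReal = B at *
  rw [← hAf, ← hBg]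
  calc ∫⁻ x, ∫⁻ y, ENNReal.ofReal (|f x| * |g y| * w x y) ∂μ ∂μ
      = ∫⁻ x, ∫⁻ y, ENNReal.ofReal (A * B) *
          ENNReal.ofReal (u x ^ (1 / r) * v y ^ (1 / s) * w x y) ∂μ ∂μ := by
        refine lintegral_congr_ae ?_
        filter_upwards [hfu] with x hx
        refine lintegral_congr_ae ?_
        filter_upwards [hgv] with y hy
        rw [hx, hy, ← ENNReal.ofReal_mul (by positivity)]
        congr 1
        ring
    _ = ENNReal.ofReal (A * B) *
          ∫⁻ x, ∫⁻ y, ENNReal.ofReal (u x ^ (1 / r) * v y ^ (1 / s) * w x y) ∂μ ∂μ := by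
        simp_rw [lintegral_const_mul' _ _ (ENNReal.ofReal_ne_top (r := A * B))]
    _ ≤ ENNReal.ofReal (A * B) * ENNReal.ofReal C := by
        grw [H u v hu hv hu0 hv0 hu1 hv1]
    _ ≤ ENNReal.ofReal (A * B) * ENNReal.ofReal (C + 1) := by
        gcongr
        linarith
    _ = _ := by
        rw [ENNReal.ofReal_mul hA0]
        ring

lemma norm_le_eunorm {k : ℕ} (x : Fin k → ℝ) : ‖x‖ ≤ eunorm x := by
  refine (pi_norm_le_iff_of_nonneg (Real.sqrt_nonneg _)).2 fun i => ?_
  rw [Real.norm_eq_abs]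
  exact Real.abs_le_sqrt (Finset.single_le_sum (f := fun j => x j ^ 2)
    (fun j _ => sq_nonneg _) (Finset.mem_univ i))

lemma eunorm_le_mul_norm {k : ℕ} (x : Fin k → ℝ) : eunorm x ≤ Real.sqrt k * ‖x‖ := by
  rw [eunorm, ← Real.sqrt_sq (norm_nonneg x), ← Real.sqrt_mul (Nat.cast_nonneg k)]
  refine Real.sqrt_le_sqrt ((Finset.sum_le_card_nsmul _ _ (‖x‖ ^ 2) fun j _ => ?_).trans ?_)
  · exact sq_le_sq' (by linarith [neg_abs_le (x j), norm_le_pi_norm x j, Real.norm_eq_abs (x j)])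
      ((le_abs_self _).trans (norm_le_pi_norm x j))
  · simp

lemma norm_le_pnorm {m n : ℕ} (x : Rsplit m n) : ‖x‖ ≤ pnorm x := by
  refine max_le ?_ ?_
  · exact (norm_le_eunorm _).trans (Real.le_sqrt_of_sq_le (by nlinarith [sq_nonneg (eunorm x.2)]))
  · exact (norm_le_eunorm _).trans (Real.le_sqrt_of_sq_le (by nlinarith [sq_nonneg (eunorm x.1)]))

lemma exists_eunorm_rpow_neg_le (k : ℕ) (e : ℝ) :
    ∃ D : ℝ, 0 < D ∧ ∀ x : Fin k → ℝ, x ≠ 0 → (eunorm x ^ e)⁻¹ ≤ D * ‖x‖ ^ (-e) := by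
  refine ⟨Real.sqrt (k + 1) ^ |e|, by positivity, fun x hx => ?_⟩
  have hx0 : 0 < ‖x‖ := norm_pos_iff.2 hx
  have h1 := norm_le_eunorm x
  have hE : 0 < eunorm x := hx0.trans_le h1
  rw [← Real.rpow_neg hE.le]
  rcases le_total 0 e with he | he
  · have hD : (1 : ℝ) ≤ Real.sqrt (k + 1) ^ |e| :=
      Real.one_le_rpow (Real.one_le_sqrt.2 (by linarith [(Nat.cast_nonneg k : (0 : ℝ) ≤ k)]))
        (abs_nonneg e)
    exact (Real.rpow_le_rpow_of_nonpos hx0 h1 (by linarith)).trans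
      (le_mul_of_one_le_left (by positivity) hD)
  · rw [abs_of_nonpos he, ← Real.mul_rpow (by positivity) hx0.le]
    refine Real.rpow_le_rpow hE.le ((eunorm_le_mul_norm x).trans ?_) (by linarith)
    gcongr
    linarith

end Norms

/-- **Stein–Weiss inequality on `ℝ^{n+m}` with partial-variable weights** (Theorem 1.5,
inequality part). -/
theorem stein_weiss_partial_weights
    (n m : ℕ) (hn : 1 ≤ n) (hm : 1 ≤ m) (p p' q q' lam α β : ℝ)
    (hp : 1 < p) (hq' : 1 < q')
    (hq : 1 / q + 1 / q' = 1) (hp' : 1 / p + 1 / p' = 1)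
    (hlam0 : 0 < lam) (hlamn : lam < n)
    (hab : 0 ≤ α + β) (habnm : lam + α + β ≤ n + m)
    (hβ : β < m / p') (hα : α < m / q)
    (hbal : 1 / p + 1 / q' + (lam + α + β) / (n + m) = 2) :
    ∃ C : ℝ, 0 < C ∧ ∀ f g : Rsplit m n → ℝ,
      MemLp f (ENNReal.ofReal q') volume → MemLp g (ENNReal.ofReal p) volume →
      ∫⁻ x, ∫⁻ y, ENNReal.ofReal
          (|f x| * |g y| / (eunorm x.1 ^ α * pnorm (x - y) ^ lam * eunorm y.1 ^ β)) ≤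
        ENNReal.ofReal C * eLpNorm f (ENNReal.ofReal q') volume *
          eLpNorm g (ENNReal.ofReal p) volume := by
  have hm0 : (0 : ℝ) < m := by exact_mod_cast hm
  have hnm : (0 : ℝ) < n + m := by positivity
  have hp0 : 0 < p := by linarith
  have hq'0 : 0 < q' := by linarith
  have key := BoundedForm.steinWeissKernel (m := m) (n := n) (a := 1 / q') (b := 1 / p)
    (c := (lam + α + β) / (n + m)) hm hn (by positivity) (by positivity)
    ((div_lt_one hq'0).2 hq') ((div_lt_one hp0).2 hp) ((div_le_one hnm).2 habnm) (by linarith)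
    hlam0 hlamn hab (by rwa [← eq_sub_of_add_eq hq, mul_one_div])
    (by rwa [← eq_sub_of_add_eq' hp', mul_one_div]) (mul_div_cancel₀ _ hnm.ne')
  obtain ⟨D₁, hD₁, h₁⟩ := exists_eunorm_rpow_neg_le m α
  obtain ⟨D₂, hD₂, h₂⟩ := exists_eunorm_rpow_neg_le m β
  have hform : BoundedForm (volume : Measure (Rsplit m n)) (1 / q') (1 / p)
      (fun x y => (eunorm x.1 ^ α * pnorm (x - y) ^ lam * eunorm y.1 ^ β)⁻¹) := by
    refine BoundedForm.mono (D := D₁ * D₂) (by positivity) key ?_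
    filter_upwards [ae_rsplit_fst_ne hm 0] with x hx
    filter_upwards [ae_rsplit_fst_ne hm 0, ae_rsplit_fst_ne hm x.1] with y hy hyx
    have hd0 : 0 < ‖x - y‖ := norm_sub_pos_iff.2 fun h => hyx (by rw [h])
    have h₃ : (pnorm (x - y) ^ lam)⁻¹ ≤ ‖x - y‖ ^ (-lam) := by
      rw [Real.rpow_neg hd0.le]
      gcongr
      exact norm_le_pnorm _
    have hE : ∀ (z : Fin m → ℝ) (e : ℝ), 0 ≤ (eunorm z ^ e)⁻¹ := fun z e =>
      inv_nonneg.2 (Real.rpow_nonneg (Real.sqrt_nonneg _) _)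
    have hP : 0 ≤ (pnorm (x - y) ^ lam)⁻¹ := inv_nonneg.2 (Real.rpow_nonneg (Real.sqrt_nonneg _) _)
    rw [mul_inv, mul_inv]
    calc (eunorm x.1 ^ α)⁻¹ * (pnorm (x - y) ^ lam)⁻¹ * (eunorm y.1 ^ β)⁻¹
        ≤ D₁ * ‖x.1‖ ^ (-α) * ‖x - y‖ ^ (-lam) * (D₂ * ‖y.1‖ ^ (-β)) :=
          mul_le_mul (mul_le_mul (h₁ _ hx) h₃ hP (by positivity)) (h₂ _ hy) (hE _ _)
            (by positivity)
      _ = _ := by ring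
  simpa only [div_eq_mul_inv (|_| * |_|)] using hform.exists_lintegral_le hq'0 hp0
end
end
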